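/- arXiv:1612.01932 — 3 statements merged into one kernel-verified Lean document; each statement's English description precedes it below -/
import Mathlib

section
/- Let w be a weight on ℝ and let δ > 1. Assume w is a one-sided A₁⁺ weight with constant at most δ, i.e., M⁻w(x) ≤ δ·w(x) for almost every x ∈ ℝ. Then for every r with 1 ≤ r < δ/(δ−1): (a) for every bounded interval (a,b), ∫_{(a,b)} wʳ dx ≤ δ^{1−r} · (r′−1)/(r′−δ) · (M⁻(w·1_{(a,b)})(b))^{r−1} · w((a,b)); and (b) for all real numbers a < b < c, (c−b)^{r−1} · ∫_{(a,b)} wʳ dx ≤ δ^{1−r} · (r′−1)/(r′−δ) · w((a,c))ʳ. -/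
open MeasureTheory Set ENNReal

noncomputable section

/-- The one-sided (backward) Hardy–Littlewood maximal operator on `ℝ`:
`M⁻f(x) = sup_{h>0} (1/h) ∫_{x-h}^x |f|`. -/
def Mminus (f : ℝ → ℝ) (x : ℝ) : ℝ≥0∞ :=
  ⨆ (h : ℝ) (_ : 0 < h),
    (∫⁻ y in Set.Ioo (x - h) x, ENNReal.ofReal |f y|) / ENNReal.ofReal h

/-- A rising sun inequality: if the primitive of `f` attains its minimum over `[a, b]` at `b`, and
its minimum over `[a, x]` at almost every `x ∉ E`, then `f` has nonpositive integral over `E`. -/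
theorem setIntegral_nonpos_of_primitive_minima {f : ℝ → ℝ} (hf : LocallyIntegrable f volume)
    {a b : ℝ} (hab : a < b) {E : Set ℝ} (hE : MeasurableSet E)
    (hb : ∀ y ∈ Icc a b, ∫ x in y..b, f x ≤ 0)
    (hx : ∀ᵐ x, x ∈ Ioo a b → x ∉ E → ∀ y ∈ Icc a x, ∫ t in y..x, f t ≤ 0) :
    ∫ x in E, f x ∂(volume.restrict (Ioo a b)) ≤ 0 := by
  have hint : ∀ u v : ℝ, IntervalIntegrable f volume u v := fun u v =>
    (hf.integrableOn_isCompact isCompact_uIcc).intervalIntegrable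
  set F : ℝ → ℝ := fun x => ∫ t in a..x, f t with hF
  have hFsub : ∀ u v, F v - F u = ∫ t in u..v, f t := fun u v =>
    intervalIntegral.integral_interval_sub_left (hint a v) (hint a u)
  have hFc : Continuous F := intervalIntegral.continuous_primitive hint a
  set m : ℝ → ℝ := fun x => sInf (F '' Icc a x) with hm
  have hbdd : ∀ x, BddBelow (F '' Icc a x) := fun x =>
    (isCompact_Icc.image hFc).bddBelow
  have hmono : MonotoneOn (fun x => -m x) (uIcc a b) := by
    intro x hx y hy hxy
    rw [uIcc_of_le hab.le] at hx
    exact neg_le_neg (csInf_le_csInf (hbdd y) ((nonempty_Icc.2 hx.1).image _)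
      (image_mono (Icc_subset_Icc_right hxy)))
  have hmF : ∀ x, a ≤ x → m x ≤ F x := fun x hx => csInf_le (hbdd x) ⟨x, ⟨hx, le_rfl⟩, rfl⟩
  have hmeq : ∀ x, a ≤ x → (∀ y ∈ Icc a x, ∫ t in y..x, f t ≤ 0) → m x = F x := by
    intro x hax h
    refine le_antisymm (hmF x hax) (le_csInf ((nonempty_Icc.2 hax).image _) ?_)
    rintro _ ⟨y, hy, rfl⟩
    have := h y hy
    rw [← hFsub] at this
    linarith
  have hd := hmono.intervalIntegral_deriv_mem_uIcc
  have hdint := hmono.intervalIntegrable_deriv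
  have hmab : -m a ≤ -m b := hmono (by simp) (by simp) hab.le
  rw [uIcc_of_le (by linarith)] at hd
  have hmb : m b = F b := hmeq b hab.le hb
  have hma : m a ≤ F a := hmF a le_rfl
  have hFba : F b - F a = ∫ x in Ioo a b, f x := by
    rw [hFsub, intervalIntegral.integral_of_le hab.le, integral_Ioc_eq_integral_Ioo]
  have hfI : IntegrableOn f (Ioo a b) := (hint a b).1.mono_set Ioo_subset_Ioc_self
  rw [intervalIntegral.integral_of_le hab.le, integral_Ioc_eq_integral_Ioo] at hd
  have hdI : IntegrableOn (deriv fun x => -m x) (Ioo a b) :=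
    hdint.1.mono_set Ioo_subset_Ioc_self
  have hpt : ∀ᵐ x ∂(volume.restrict (Ioo a b)),
      -(Eᶜ.indicator f x) ≤ deriv (fun x => -m x) x := by
    rw [ae_restrict_iff' measurableSet_Ioo]
    filter_upwards [hx, LocallyIntegrable.ae_hasDerivAt_integral hf, hmono.ae_differentiableWithinAt_of_mem]
      with x hx1 hx2 hx3 hxI
    have hnhds : uIcc a b ∈ nhds x := by
      rw [uIcc_of_le hab.le]; exact Icc_mem_nhds hxI.1 hxI.2
    have hdiff := (hx3 (mem_of_mem_nhds hnhds)).differentiableAt hnhds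
    by_cases hxE : x ∈ E
    · rw [indicator_of_notMem (by simpa using hxE), neg_zero,
        ← derivWithin_of_mem_nhds hnhds]
      exact hmono.derivWithin_nonneg
    · rw [indicator_of_mem hxE]
      have h1 : HasDerivAt F (f x) x := hx2 a
      have h2 := h1.add hdiff.hasDerivAt
      have h3 : IsLocalMin (F + fun x => -m x) x := by
        filter_upwards [Ioi_mem_nhds hxI.1] with z hz
        have := hmF z (le_of_lt hz)
        have := hmeq x hxI.1.le (hx1 hxI hxE)
        simp only [Pi.add_apply]
        linarith
      have := h3.hasDerivAt_eq_zero h2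
      linarith
  have h1 := integral_mono_ae (hfI.indicator hE.compl).neg hdI hpt
  simp only [Pi.neg_apply] at h1
  rw [integral_neg, integral_indicator hE.compl] at h1
  have h2 := integral_add_compl hE hfI
  linarith [hd.2]

/-- A truncated reverse Hölder inequality, from a comparison of `w` with `δ * t` on each
superlevel set `{t ≤ w}`, `t₀ ≤ t`. -/
theorem integral_mul_truncation_rpow_le {α : Type*} [MeasurableSpace α] {μ : Measure α}
    [IsFiniteMeasure μ] {w : α → ℝ} (hw : Measurable w) (hw0 : ∀ x, 0 ≤ w x)
    (hi : Integrable w μ) {δ t₀ r n : ℝ} (hδ : 1 < δ) (ht₀ : 0 < t₀) (hr : 1 < r)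
    (hD : 0 < r - δ * (r - 1)) (hn : t₀ ≤ n)
    (h : ∀ t, t₀ ≤ t → ∫ x in {x | t ≤ w x}, (w x - δ * t) ∂μ ≤ 0) :
    Integrable (fun x => w x * (min (w x) n) ^ (r - 1)) μ ∧
    ∫ x, w x * (min (w x) n) ^ (r - 1) ∂μ ≤ t₀ ^ (r - 1) / (r - δ * (r - 1)) * ∫ x, w x ∂μ := by
  have hn0 : 0 < n := ht₀.trans_le hn
  set κ := δ * (r - 1) / r with hκ
  set m : α → ℝ := fun x => max t₀ (min (w x) n) with hm
  have hmm : Measurable m := by fun_prop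
  have hm0 : ∀ x, t₀ ≤ m x := fun x => le_max_left _ _
  have hmn : ∀ x, m x ≤ n := fun x => max_le hn (min_le_right _ _)
  have hbd : ∀ {v : α → ℝ} (p : ℝ), 0 ≤ p → Measurable v → (∀ x, 0 ≤ v x) → (∀ x, v x ≤ n) →
      (∀ x, ‖v x ^ p‖ ≤ n ^ p) := by
    intro v p hp hv h0 h1 x
    rw [Real.norm_of_nonneg (Real.rpow_nonneg (h0 x) p)]
    exact Real.rpow_le_rpow (h0 x) (h1 x) hp
  have hpm : ∀ {v : α → ℝ} (p : ℝ), Measurable v →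
      AEStronglyMeasurable (fun x => v x ^ p) μ :=
    fun p hv => (hv.pow_const p).aestronglyMeasurable
  have i0 : Integrable (fun x => w x * (min (w x) n) ^ (r - 1)) μ :=
    hi.mul_bdd (c := n ^ (r - 1)) (hpm _ (by fun_prop))
      (.of_forall (hbd (v := fun x => min (w x) n) (r - 1) (by linarith) (by fun_prop)
        (fun x => le_min (hw0 x) hn0.le) (fun x => min_le_right _ _)))
  refine ⟨i0, ?_⟩
  have i1 : Integrable (fun x => w x * (m x) ^ (r - 1)) μ :=
    hi.mul_bdd (c := n ^ (r - 1)) (hpm _ hmm)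
      (.of_forall (hbd (r - 1) (by linarith) hmm (fun x => ht₀.le.trans (hm0 x)) hmn))
  have i2 : Integrable (fun x => (m x) ^ r) μ :=
    Integrable.of_bound (C := n ^ r) (hpm _ hmm)
      (.of_forall (hbd r (by linarith) hmm (fun x => ht₀.le.trans (hm0 x)) hmn))
  set J : α → ℝ := fun x => w x * ((m x) ^ (r - 1) - t₀ ^ (r - 1)) - κ * ((m x) ^ r - t₀ ^ r)
    with hJ
  have iJ : Integrable J μ := by
    have := (i1.sub (hi.mul_const (t₀ ^ (r - 1)))).sub ((i2.sub (integrable_const (t₀ ^ r))).const_mul κ)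
    refine this.congr (.of_forall fun x => ?_)
    simp [hJ]; ring
  set ν := (volume : Measure ℝ).restrict (Ioc t₀ n) with hν
  set S : Set (α × ℝ) := {p | p.2 ≤ w p.1} with hS
  have hSm : MeasurableSet S := measurableSet_le (by fun_prop) (by fun_prop)
  have hk : ∀ p : ℝ, ∀ u v : ℝ, t₀ ≤ u → t₀ ≤ v →
      IntervalIntegrable (fun t : ℝ => t ^ p) volume u v := by
    intro p u v hu hv
    refine intervalIntegral.intervalIntegrable_rpow (Or.inr fun h0 => ?_)
    exact absurd ((le_min hu hv).trans h0.1) (not_le.2 ht₀)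
  have hHint : Integrable (fun p : α × ℝ => S.indicator
      (fun p => w p.1 * ((r - 1) * p.2 ^ (r - 2)) - δ * (r - 1) * p.2 ^ (r - 1)) p)
      (μ.prod ν) := by
    refine Integrable.indicator (Integrable.sub ?_ ?_) hSm
    · exact hi.mul_prod ((hk (r - 2) t₀ n le_rfl hn).1.const_mul (r - 1))
    · exact (integrable_const (1 : ℝ)).mul_prod ((hk (r - 1) t₀ n le_rfl hn).1.const_mul (δ * (r - 1)))
        |>.congr (.of_forall fun x => by simp)
  have hswap := integral_integral_swap (f := fun x t => S.indicator
      (fun p => w p.1 * ((r - 1) * p.2 ^ (r - 2)) - δ * (r - 1) * p.2 ^ (r - 1)) (x, t)) hHint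
  have hinner : ∀ x, ∫ t, S.indicator
      (fun p => w p.1 * ((r - 1) * p.2 ^ (r - 2)) - δ * (r - 1) * p.2 ^ (r - 1)) (x, t) ∂ν
      = J x := by
    intro x
    have e1 : (fun t => S.indicator
      (fun p => w p.1 * ((r - 1) * p.2 ^ (r - 2)) - δ * (r - 1) * p.2 ^ (r - 1)) (x, t))
      = (Iic (w x)).indicator
        (fun t => w x * ((r - 1) * t ^ (r - 2)) - δ * (r - 1) * t ^ (r - 1)) := by
      ext t; simp [indicator, hS]
    have e2 : Iic (w x) ∩ Ioc t₀ n = Ioc t₀ (m x) := by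
      ext t
      simp only [mem_inter_iff, mem_Iic, mem_Ioc, hm, le_max_iff, le_min_iff]
      constructor
      · rintro ⟨h1, h2, h3⟩; exact ⟨h2, Or.inr ⟨h1, h3⟩⟩
      · rintro ⟨h1, h2 | h2⟩
        · exact absurd h2 (not_le.2 h1)
        · exact ⟨h2.1, h1, h2.2⟩
    rw [e1, integral_indicator measurableSet_Iic, hν, Measure.restrict_restrict measurableSet_Iic,
      e2, ← intervalIntegral.integral_of_le (hm0 x), intervalIntegral.integral_sub,
      intervalIntegral.integral_const_mul, intervalIntegral.integral_const_mul,
      intervalIntegral.integral_const_mul, integral_rpow, integral_rpow]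
    · simp only [hJ, hκ]
      have hr1 : r - 1 ≠ 0 := by linarith
      have hr0 : r ≠ 0 := by linarith
      rw [show r - 2 + 1 = r - 1 by ring, show r - 1 + 1 = r by ring]
      field_simp
    · left; linarith
    · by_cases h2 : -1 < r - 2
      · exact Or.inl h2
      · exact absurd (by linarith) h2
    · exact ((hk _ _ _ le_rfl (hm0 x)).const_mul _).const_mul _
    · exact (hk _ _ _ le_rfl (hm0 x)).const_mul _
  simp only [hinner] at hswap
  have hJ0 : ∫ x, J x ∂μ ≤ 0 := by
    rw [hswap]
    refine integral_nonpos_of_ae ?_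
    rw [hν, Filter.EventuallyLE, ae_restrict_iff' measurableSet_Ioc]
    refine .of_forall fun t ht => ?_
    have ht0 : 0 < t := ht₀.trans ht.1
    have e1 : (fun x => S.indicator
      (fun p => w p.1 * ((r - 1) * p.2 ^ (r - 2)) - δ * (r - 1) * p.2 ^ (r - 1)) (x, t))
      = {x | t ≤ w x}.indicator (fun x => ((r - 1) * t ^ (r - 2)) * (w x - δ * t)) := by
      have : t ^ (r - 1) = t ^ (r - 2) * t := by
        rw [← Real.rpow_add_one ht0.ne']; ring_nf
      ext x; simp only [indicator, hS, mem_ofPred_eq, this]; split_ifs <;> ring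
    rw [e1, integral_indicator (measurableSet_le measurable_const hw), integral_const_mul]
    exact mul_nonpos_of_nonneg_of_nonpos
      (mul_nonneg (by linarith) (Real.rpow_nonneg ht0.le _)) (h t ht.1.le)
  set A := {x | t₀ ≤ w x} with hA
  have hAm : MeasurableSet A := measurableSet_le measurable_const hw
  have iA : Integrable (A.indicator fun x => w x - δ * t₀) μ :=
    (hi.sub (integrable_const _)).indicator hAm
  have hA0 : ∫ x, A.indicator (fun x => w x - δ * t₀) x ∂μ ≤ 0 := by
    rw [integral_indicator hAm]; exact h t₀ le_rfl
  have hr0 : 0 < r := by linarith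
  have hκ1 : 1 - κ = (r - δ * (r - 1)) / r := by rw [hκ]; field_simp
  have hT : 0 < t₀ ^ (r - 1) := Real.rpow_pos_of_pos ht₀ _
  have hTr : t₀ ^ r = t₀ ^ (r - 1) * t₀ := by
    rw [← Real.rpow_add_one ht₀.ne']; ring_nf
  have hpt : ∀ x, (1 - κ) * (w x * (min (w x) n) ^ (r - 1)) ≤
      t₀ ^ (r - 1) / r * w x + J x +
        (r - 1) / r * t₀ ^ (r - 1) * A.indicator (fun x => w x - δ * t₀) x := by
    intro x
    by_cases hx : x ∈ A
    · have hmx : m x = min (w x) n := max_eq_right (le_min hx hn)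
      have hmpos : 0 < m x := ht₀.trans_le (hm0 x)
      have hmr : (m x) ^ r = (m x) ^ (r - 1) * m x := by
        rw [← Real.rpow_add_one hmpos.ne']; ring_nf
      have hle : (m x) ^ r ≤ w x * (m x) ^ (r - 1) := by
        rw [hmr, mul_comm]
        exact mul_le_mul_of_nonneg_right (hmx ▸ min_le_left _ _) (Real.rpow_nonneg hmpos.le _)
      have hκ0 : 0 ≤ κ := by
        rw [hκ]; exact div_nonneg (mul_nonneg (by linarith) (by linarith)) hr0.le
      have := mul_le_mul_of_nonneg_left hle hκ0
      rw [indicator_of_mem hx, ← hmx]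
      simp only [hJ]
      have e : t₀ ^ (r - 1) / r * w x + (r - 1) / r * t₀ ^ (r - 1) * (w x - δ * t₀)
          = t₀ ^ (r - 1) * w x - κ * t₀ ^ r := by
        rw [hTr, hκ]; field_simp; ring
      linarith
    · have hx' : w x < t₀ := not_le.1 hx
      have hmx : m x = t₀ := max_eq_left ((min_le_left _ _).trans hx'.le)
      rw [indicator_of_notMem hx]
      simp only [hJ, hmx, sub_self, mul_zero, add_zero]
      rw [min_eq_left (hx'.le.trans hn), hκ1]
      have h1 : (w x) ^ (r - 1) ≤ t₀ ^ (r - 1) :=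
        Real.rpow_le_rpow (hw0 x) hx'.le (by linarith)
      have h2 : r - δ * (r - 1) ≤ 1 := by nlinarith
      have h3 : w x * w x ^ (r - 1) ≤ t₀ ^ (r - 1) * w x := by
        rw [mul_comm]; exact mul_le_mul_of_nonneg_right h1 (hw0 x)
      have h4 : 0 ≤ w x * w x ^ (r - 1) := mul_nonneg (hw0 x) (Real.rpow_nonneg (hw0 x) _)
      rw [div_mul_eq_mul_div, div_mul_eq_mul_div]
      refine div_le_div_of_nonneg_right ?_ hr0.le
      nlinarith
  have hfin := integral_mono (i0.const_mul (1 - κ))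
    (((hi.const_mul (t₀ ^ (r - 1) / r)).add iJ).add
      (iA.const_mul ((r - 1) / r * t₀ ^ (r - 1)))) hpt
  rw [integral_add' ((hi.const_mul _).add iJ) (iA.const_mul _), integral_add' (hi.const_mul _) iJ,
    integral_const_mul, integral_const_mul, integral_const_mul, hκ1] at hfin
  have hc : (r - 1) / r * t₀ ^ (r - 1) * ∫ x, A.indicator (fun x => w x - δ * t₀) x ∂μ ≤ 0 :=
    mul_nonpos_of_nonneg_of_nonpos
      (mul_nonneg (div_nonneg (by linarith) hr0.le) hT.le) hA0
  have hfin2 : (r - δ * (r - 1)) / r * ∫ x, w x * (min (w x) n) ^ (r - 1) ∂μ ≤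
      t₀ ^ (r - 1) / r * ∫ x, w x ∂μ := by linarith
  rw [div_mul_eq_mul_div, div_mul_eq_mul_div, div_le_div_iff_of_pos_right hr0] at hfin2
  rw [div_mul_eq_mul_div, le_div_iff₀ hD]
  linarith

theorem lintegral_rpow_le_of_measurable {w : ℝ → ℝ} (hw : Measurable w) (hw0 : ∀ x, 0 ≤ w x)
    (hloc : LocallyIntegrable w volume) {δ r l a b : ℝ} (hδ : 1 < δ) (hr : 1 < r)
    (hD : 0 < δ - (δ - 1) * r) (hl : 0 < l) (hab : a < b)
    (hb : ∀ y ∈ Icc a b, ∫ x in y..b, w x ≤ l * (b - y))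
    (hA : ∀ᵐ x, x ∈ Ioo a b → ∀ y ∈ Icc a x, ∫ t in y..x, w t ≤ δ * w x * (x - y)) :
    ∫⁻ x in Ioo a b, ENNReal.ofReal (w x ^ r) ≤
      ENNReal.ofReal (δ ^ (1 - r) * (1 / (δ - (δ - 1) * r)) * l ^ (r - 1) *
        ∫ x in Ioo a b, w x) := by
  have hδ0 : 0 < δ := by linarith
  have hint : ∀ u v : ℝ, IntervalIntegrable w volume u v := fun u v =>
    (hloc.integrableOn_isCompact isCompact_uIcc).intervalIntegrable
  have hi : IntegrableOn w (Ioo a b) := (hint a b).1.mono_set Ioo_subset_Ioc_self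
  have hsub : ∀ c u v : ℝ, ∫ x in u..v, (w x - c) = (∫ x in u..v, w x) - c * (v - u) := by
    intro c u v
    rw [intervalIntegral.integral_sub (hint u v) intervalIntegrable_const,
      intervalIntegral.integral_const, smul_eq_mul, mul_comm c]
  have hgood : ∀ t, l / δ ≤ t →
      ∫ x in {x | t ≤ w x}, (w x - δ * t) ∂(volume.restrict (Ioo a b)) ≤ 0 := by
    intro t ht
    have hlt : l ≤ δ * t := by rw [mul_comm]; exact (div_le_iff₀ hδ0).1 ht
    refine setIntegral_nonpos_of_primitive_minima (hloc.sub (locallyIntegrable_const _)) hab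
      (measurableSet_le measurable_const hw) ?_ ?_
    · intro y hy
      have := hb y hy
      have h2 : l * (b - y) ≤ δ * t * (b - y) :=
        mul_le_mul_of_nonneg_right hlt (by linarith [hy.2])
      simp only [Pi.sub_apply]
      rw [hsub]
      linarith
    · filter_upwards [hA] with x hx hxI hxE y hy
      have h1 := hx hxI y hy
      have h2 : δ * w x * (x - y) ≤ δ * t * (x - y) :=
        mul_le_mul_of_nonneg_right (mul_le_mul_of_nonneg_left (not_le.1 hxE).le hδ0.le)
          (by linarith [hy.2])
      simp only [Pi.sub_apply]
      rw [hsub]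
      linarith
  have hDe : δ - (δ - 1) * r = r - δ * (r - 1) := by ring
  have hce : δ ^ (1 - r) * (1 / (δ - (δ - 1) * r)) * l ^ (r - 1) =
      (l / δ) ^ (r - 1) / (r - δ * (r - 1)) := by
    rw [Real.div_rpow hl.le hδ0.le, hDe, show 1 - r = -(r - 1) by ring, Real.rpow_neg hδ0.le]
    ring
  rw [hce]
  have key := fun (n : ℝ) (hn : l / δ ≤ n) =>
    integral_mul_truncation_rpow_le (μ := volume.restrict (Ioo a b)) hw hw0 hi hδ
      (div_pos hl hδ0) hr (hDe ▸ hD) hn hgood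
  have hlim : Filter.Tendsto (fun n : ℕ => ∫⁻ x in Ioo a b,
      ENNReal.ofReal (w x * (min (w x) n) ^ (r - 1))) Filter.atTop
      (nhds (∫⁻ x in Ioo a b, ENNReal.ofReal (w x ^ r))) := by
    refine lintegral_tendsto_of_tendsto_of_monotone (fun n => by fun_prop (disch := linarith)) ?_ ?_
    · refine .of_forall fun x n k hnk => ENNReal.ofReal_le_ofReal ?_
      refine mul_le_mul_of_nonneg_left (Real.rpow_le_rpow (le_min (hw0 x) n.cast_nonneg)
        (min_le_min_left _ (Nat.cast_le.2 hnk)) (by linarith)) (hw0 x)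
    · refine .of_forall fun x => tendsto_const_nhds.congr' ?_
      filter_upwards [Filter.eventually_ge_atTop ⌈w x⌉₊] with n hn
      rw [min_eq_left ((Nat.le_ceil _).trans (Nat.cast_le.2 hn))]
      rcases (hw0 x).eq_or_lt with h | h
      · rw [← h, zero_mul, Real.zero_rpow (by linarith)]
      · rw [mul_comm, ← Real.rpow_add_one h.ne', sub_add_cancel]
  refine le_of_tendsto hlim ?_
  filter_upwards [Filter.eventually_ge_atTop ⌈l / δ⌉₊] with n hn
  obtain ⟨h1, h2⟩ := key n ((Nat.le_ceil _).trans (Nat.cast_le.2 hn))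
  rw [← ofReal_integral_eq_lintegral_ofReal h1 (.of_forall fun x =>
    mul_nonneg (hw0 x) (Real.rpow_nonneg (le_min (hw0 x) n.cast_nonneg) _))]
  exact ENNReal.ofReal_le_ofReal h2

theorem lintegral_Ioo_le_of_Mminus_le {f : ℝ → ℝ} {x : ℝ} {c : ℝ≥0∞} (h : Mminus f x ≤ c)
    {y : ℝ} (hy : y < x) :
    ∫⁻ t in Ioo y x, ENNReal.ofReal |f t| ≤ c * ENNReal.ofReal (x - y) := by
  have h1 : (∫⁻ t in Ioo (x - (x - y)) x, ENNReal.ofReal |f t|) / ENNReal.ofReal (x - y) ≤ c :=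
    (le_iSup₂ (f := fun (h : ℝ) (_ : 0 < h) =>
      (∫⁻ t in Ioo (x - h) x, ENNReal.ofReal |f t|) / ENNReal.ofReal h) (x - y)
      (sub_pos.2 hy)).trans h
  rw [_root_.sub_sub_cancel] at h1
  exact (ENNReal.div_le_iff (by simpa using hy) ENNReal.ofReal_ne_top).1 h1

theorem lintegral_rpow_le_of_Mminus_le {w : ℝ → ℝ} (hw : ∀ x, 0 ≤ w x)
    (hloc : LocallyIntegrable w volume) {δ : ℝ} (hδ : 1 < δ)
    (hA1 : ∀ᵐ x : ℝ ∂volume, Mminus w x ≤ ENNReal.ofReal (δ * w x))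
    {r : ℝ} (hr : 1 ≤ r) (hD : 0 < δ - (δ - 1) * r) {l : ℝ} (hl : 0 ≤ l) {a b : ℝ} (hab : a < b)
    (hb : ∀ y ∈ Ico a b, ∫⁻ x in Ioo y b, ENNReal.ofReal (w x) ≤ ENNReal.ofReal (l * (b - y))) :
    ∫⁻ x in Ioo a b, ENNReal.ofReal (w x ^ r) ≤
      ENNReal.ofReal (δ ^ (1 - r) * (1 / (δ - (δ - 1) * r))) * ENNReal.ofReal l ^ (r - 1) *
        ∫⁻ x in Ioo a b, ENNReal.ofReal (w x) := by
  rcases hr.eq_or_lt with rfl | hr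
  · simp
  have hm := hloc.aestronglyMeasurable
  set v : ℝ → ℝ := fun x => max (hm.mk w x) 0 with hv
  have hvm : Measurable v := hm.stronglyMeasurable_mk.measurable.max measurable_const
  have hwv : w =ᵐ[volume] v := by
    filter_upwards [hm.ae_eq_mk] with x hx
    rw [hv]; simp only; rw [← hx, max_eq_left (hw x)]
  have hv0 : ∀ x, 0 ≤ v x := fun x => le_max_right _ _
  have hvloc : LocallyIntegrable v volume := fun x => by
    obtain ⟨s, hs, hi⟩ := hloc x
    exact ⟨s, hs, hi.congr (ae_restrict_of_ae hwv)⟩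
  have hlv : ∀ s : Set ℝ, ∫⁻ x in s, ENNReal.ofReal (w x) = ∫⁻ x in s, ENNReal.ofReal (v x) :=
    fun s => lintegral_congr_ae (ae_restrict_of_ae (hwv.mono fun x hx => by simp only [hx]))
  have hlvr : ∫⁻ x in Ioo a b, ENNReal.ofReal (w x ^ r) =
      ∫⁻ x in Ioo a b, ENNReal.ofReal (v x ^ r) :=
    lintegral_congr_ae (ae_restrict_of_ae (hwv.mono fun x hx => by simp only [hx]))
  have hvi : ∀ y x : ℝ, IntegrableOn v (Ioo y x) := fun y x =>
    (hvloc.integrableOn_isCompact isCompact_Icc).mono_set Ioo_subset_Icc_self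
  have hof : ∀ y x : ℝ, ENNReal.ofReal (∫ t in Ioo y x, v t) =
      ∫⁻ t in Ioo y x, ENNReal.ofReal (v t) := fun y x =>
    ofReal_integral_eq_lintegral_ofReal (hvi y x) (.of_forall hv0)
  have hreal : ∀ y x c : ℝ, y ≤ x → 0 ≤ c →
      (∫⁻ t in Ioo y x, ENNReal.ofReal (w t) ≤ ENNReal.ofReal c) → ∫ t in y..x, v t ≤ c := by
    intro y x c hyx hc h
    rw [hlv, ← hof, ENNReal.ofReal_le_ofReal_iff hc] at h
    rwa [intervalIntegral.integral_of_le hyx, integral_Ioc_eq_integral_Ioo]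
  have hδ0 : 0 < δ := by linarith
  rcases hl.eq_or_lt with rfl | hl
  · have h0 := hb a ⟨le_rfl, hab⟩
    rw [hlv, zero_mul, ENNReal.ofReal_zero, nonpos_iff_eq_zero,
      lintegral_eq_zero_iff (by fun_prop)] at h0
    refine le_of_eq_of_le ?_ zero_le
    rw [hlvr, lintegral_eq_zero_iff (by fun_prop (disch := linarith))]
    filter_upwards [h0] with x hx
    have : v x = 0 := le_antisymm (by simpa using hx) (hv0 x)
    simp [this, Real.zero_rpow (by linarith : r ≠ 0)]
  · have hmain := lintegral_rpow_le_of_measurable hvm hv0 hvloc hδ hr hD hl hab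
      (fun y hy => by
        rcases hy.2.eq_or_lt with rfl | h
        · simp
        · exact hreal _ _ _ hy.2 (mul_nonneg hl.le (by linarith)) (hb y ⟨hy.1, h⟩))
      (by
        filter_upwards [hA1, hwv] with x hx hxv _ y hy
        rcases hy.2.eq_or_lt with rfl | h
        · simp
        · refine hreal _ _ _ hy.2 (mul_nonneg (mul_nonneg hδ0.le (hv0 x)) (by linarith)) ?_
          have := lintegral_Ioo_le_of_Mminus_le hx h
          simp only [abs_of_nonneg (hw _)] at this
          rwa [hxv, ← ENNReal.ofReal_mul (mul_nonneg hδ0.le (hv0 x))] at this)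
    have hC : 0 ≤ δ ^ (1 - r) * (1 / (δ - (δ - 1) * r)) := by positivity
    rw [hlvr, hlv, ← hof, ENNReal.ofReal_rpow_of_pos hl, ← ENNReal.ofReal_mul hC,
      ← ENNReal.ofReal_mul (by positivity)]
    exact hmain

/-- Sharp reverse Hölder inequality for one-sided `A₁⁺` weights on `ℝ`
(`M⁻w ≤ δ w` a.e.).  The constant `δ^{1-r}(r'-1)/(r'-δ)` is written in the
equivalent form `δ^{1-r}/(δ-(δ-1)r)`, valid also at `r = 1`. -/
theorem stmt8 (w : ℝ → ℝ) (hw : ∀ x, 0 ≤ w x) (hloc : LocallyIntegrable w volume)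
    (δ : ℝ) (hδ : 1 < δ)
    (hA1 : ∀ᵐ x : ℝ ∂volume, Mminus w x ≤ ENNReal.ofReal (δ * w x))
    (r : ℝ) (hr1 : 1 ≤ r) (hr2 : r < δ / (δ - 1)) :
    (∀ a b : ℝ, a < b →
        (∫⁻ x in Set.Ioo a b, ENNReal.ofReal (w x ^ r)) ≤
          ENNReal.ofReal (δ ^ (1 - r) * (1 / (δ - (δ - 1) * r))) *
            (Mminus ((Set.Ioo a b).indicator w) b) ^ (r - 1) *
            ∫⁻ x in Set.Ioo a b, ENNReal.ofReal (w x)) ∧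
      (∀ a b c : ℝ, a < b → b < c →
        ENNReal.ofReal ((c - b) ^ (r - 1)) *
            ∫⁻ x in Set.Ioo a b, ENNReal.ofReal (w x ^ r) ≤
          ENNReal.ofReal (δ ^ (1 - r) * (1 / (δ - (δ - 1) * r))) *
            (∫⁻ x in Set.Ioo a c, ENNReal.ofReal (w x)) ^ r) := by
  have hδ1 : 0 < δ - 1 := by linarith
  have hD : 0 < δ - (δ - 1) * r := by
    rw [lt_div_iff₀ hδ1] at hr2
    linarith
  have hC : 0 < δ ^ (1 - r) * (1 / (δ - (δ - 1) * r)) := by positivity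
  refine ⟨fun a b hab => ?_, fun a b c hab hbc => ?_⟩
  · by_cases htop : Mminus ((Ioo a b).indicator w) b = ∞
    · rcases hr1.eq_or_lt with rfl | hr
      · simp
      by_cases h0 : ∫⁻ x in Ioo a b, ENNReal.ofReal (w x) = 0
      · refine (lintegral_rpow_le_of_Mminus_le hw hloc hδ hA1 hr1 hD le_rfl hab
          fun y hy => ?_).trans (by simp [h0])
        rw [zero_mul, ENNReal.ofReal_zero, ← h0]
        exact lintegral_mono_set (Ioo_subset_Ioo_left hy.1)
      · rw [htop, ENNReal.top_rpow_of_pos (by linarith), ENNReal.mul_top (by simpa using hC),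
          ENNReal.top_mul h0]
        exact le_top
    · have hmain := lintegral_rpow_le_of_Mminus_le hw hloc hδ hA1 hr1 hD
        (ENNReal.toReal_nonneg (a := Mminus ((Ioo a b).indicator w) b)) hab ?_
      · rwa [ENNReal.ofReal_toReal htop] at hmain
      intro y hy
      rw [ENNReal.ofReal_mul ENNReal.toReal_nonneg, ENNReal.ofReal_toReal htop]
      refine le_of_eq_of_le ?_ (lintegral_Ioo_le_of_Mminus_le le_rfl hy.2)
      refine setLIntegral_congr_fun measurableSet_Ioo fun x hx => ?_
      rw [indicator_of_mem (Ioo_subset_Ioo_left hy.1 hx), abs_of_nonneg (hw x)]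
  · have hint : ∀ u v : ℝ, IntervalIntegrable w volume u v := fun u v =>
      (hloc.integrableOn_isCompact isCompact_uIcc).intervalIntegrable
    have hlint : ∀ u v : ℝ, u ≤ v →
        ∫⁻ x in Ioo u v, ENNReal.ofReal (w x) = ENNReal.ofReal (∫ x in u..v, w x) := by
      intro u v huv
      rw [intervalIntegral.integral_of_le huv, integral_Ioc_eq_integral_Ioo]
      exact (ofReal_integral_eq_lintegral_ofReal
        ((hint u v).1.mono_set Ioo_subset_Ioc_self) (.of_forall hw)).symm
    have hsub : ∀ x u v : ℝ, (∫ t in x..v, w t) - (∫ t in x..u, w t) = ∫ t in u..v, w t :=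
      fun x u v => intervalIntegral.integral_interval_sub_left (hint x v) (hint x u)
    have hcb : 0 < c - b := sub_pos.2 hbc
    have hac : a < c := hab.trans hbc
    set W := ∫ x in a..c, w x with hW
    have hW0 : 0 ≤ W := intervalIntegral.integral_nonneg hac.le fun x _ => hw x
    set L := W / (c - b) with hL
    have hLW : L * (c - b) = W := div_mul_cancel₀ _ hcb.ne'
    have hL0 : 0 ≤ L := div_nonneg hW0 hcb.le
    have hGc : Continuous fun x => (∫ t in a..x, w t) - L * (x - a) :=
      (intervalIntegral.continuous_primitive hint a).sub (by fun_prop)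
    obtain ⟨d, hd, hmin⟩ := isCompact_Icc.exists_isMinOn (nonempty_Icc.2 hbc.le) hGc.continuousOn
    have hmin' : ∀ y ∈ Icc b c, ∫ t in y..d, w t ≤ L * (d - y) := by
      intro y hy
      have := isMinOn_iff.1 hmin y hy
      rw [← hsub a y d]
      linarith
    have had : a < d := hab.trans_le hd.1
    have hmain := lintegral_rpow_le_of_Mminus_le hw hloc hδ hA1 hr1 hD hL0 had ?_
    · have hWe : ∫⁻ x in Ioo a c, ENNReal.ofReal (w x) = ENNReal.ofReal W := hlint a c hac.le
      have h1 : ∫⁻ x in Ioo a b, ENNReal.ofReal (w x ^ r) ≤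
          ENNReal.ofReal (δ ^ (1 - r) * (1 / (δ - (δ - 1) * r))) * ENNReal.ofReal L ^ (r - 1) *
            ENNReal.ofReal W := by
        refine (lintegral_mono_set (Ioo_subset_Ioo_right hd.1)).trans (hmain.trans ?_)
        rw [← hWe]
        gcongr
        exact hd.2
      rw [hWe]
      have h2 : ENNReal.ofReal W ^ r = ENNReal.ofReal (c - b) ^ (r - 1) *
          ENNReal.ofReal L ^ (r - 1) * ENNReal.ofReal W := by
        rw [← ENNReal.mul_rpow_of_nonneg _ _ (by linarith), ← ENNReal.ofReal_mul hcb.le,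
          mul_comm (c - b), hLW]
        nth_rewrite 3 [← ENNReal.rpow_one (ENNReal.ofReal W)]
        rw [← ENNReal.rpow_add_of_nonneg _ _ (by linarith) zero_le_one, sub_add_cancel]
      rw [h2, ← ENNReal.ofReal_rpow_of_pos hcb]
      refine (mul_le_mul_right h1 _).trans (le_of_eq ?_)
      ring
    · intro y hy
      rw [hlint y d hy.2.le]
      refine ENNReal.ofReal_le_ofReal ?_
      rcases le_total b y with hby | hyb
      · exact hmin' y ⟨hby, hy.2.le.trans hd.2⟩
      · have h1 := hmin' c ⟨hbc.le, le_rfl⟩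
        have h2 : 0 ≤ ∫ x in a..y, w x := intervalIntegral.integral_nonneg hy.1 fun x _ => hw x
        have h3 := hsub a y d
        have h4 := hsub a c d
        have h5 : L * b ≥ L * y := mul_le_mul_of_nonneg_left hyb hL0
        linarith
end
end

section
/- Let w be a weight on ℝ and let δ > 1. Assume the one-sided Fujii–Wilson condition with constant δ: for every bounded interval J, ∫_J M⁻(w·1_J) dx ≤ δ·w(J). Then for every r with 1 ≤ r < δ/(δ−1) and every bounded interval (a,b), one has ∫_{(a,b)} M⁻(w·1_{(a,b)})ʳ dx ≤ δ^{1−r} · (r′−1)/(r′−δ) · (M⁻_{[2]}(w·1_{(a,b)})(b))^{r−1} · ∫_{(a,b)} M⁻(w·1_{(a,b)}) dx. -/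
open MeasureTheory Set ENNReal

noncomputable section

/-- The iterated (localized) one-sided maximal operator
`M⁻_{[2]}f(x) = sup_{h>0} (1/h) ∫_{x-h}^x M⁻(f·1_{(x-h,x)})(y) dy`. -/
def Mminus2 (f : ℝ → ℝ) (x : ℝ) : ℝ≥0∞ :=
  ⨆ (h : ℝ) (_ : 0 < h),
    (∫⁻ y in Set.Ioo (x - h) x, Mminus ((Set.Ioo (x - h) x).indicator f) y) /
      ENNReal.ofReal h

theorem layer_cake_truncated {α : Type*} [MeasurableSpace α] (μ : Measure α) [IsFiniteMeasure μ]
    {f : α → ℝ} (hf : Measurable f) {δ r L N : ℝ} (hδ : 0 < δ)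
    (hr : 1 < r) (hL : 0 < L)
    (H : ∀ t, L ≤ t → ∫⁻ x in {x | t < f x}, ENNReal.ofReal (f x) ∂μ ≤
      ENNReal.ofReal (δ * t) * μ {x | t < f x}) :
    ∫⁻ x, ENNReal.ofReal (f x) *
        ENNReal.ofReal ((max L (min (f x) N)) ^ (r - 1) - L ^ (r - 1)) ∂μ ≤
      ∫⁻ x, ENNReal.ofReal (δ * (r - 1) / r * ((max L (min (f x) N)) ^ r - L ^ r)) ∂μ := by
  set h : α → ℝ := fun x => max L (min (f x) N) - L with hh
  have hh0 : ∀ x, 0 ≤ h x := fun x => sub_nonneg.2 (le_max_left _ _)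
  have hhm : Measurable h := by fun_prop
  have cont : ∀ s : ℝ, ∀ t > 0, ContinuousOn (fun u : ℝ => (u + L) ^ s) (uIcc 0 t) := by
    intro s t ht u hu
    rw [uIcc_of_le ht.le] at hu
    have : u + L ≠ 0 := by linarith [hu.1]
    exact ContinuousAt.continuousWithinAt (by fun_prop (disch := simpa using Or.inl this))
  have prim : ∀ s : ℝ, 0 < s → ∀ t, 0 ≤ t →
      ∫ u in (0:ℝ)..t, s * (u + L) ^ (s - 1) = (t + L) ^ s - L ^ s := by
    intro s hs t ht
    rw [intervalIntegral.integral_const_mul,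
      intervalIntegral.integral_comp_add_right (fun u => u ^ (s - 1)), integral_rpow (by left; linarith)]
    simp
    field_simp
  have hsets : ∀ t, 0 < t →
      (μ.withDensity fun x => ENNReal.ofReal (f x)) {x | t < h x} ≤
        ENNReal.ofReal (δ * (t + L)) * μ {x | t < h x} := by
    intro t ht
    rw [withDensity_apply _ (measurableSet_lt measurable_const hhm)]
    by_cases htN : t + L < N
    · have : {x | t < h x} = {x | t + L < f x} := by
        ext x
        simp only [hh, mem_ofPred_eq, lt_sub_iff_add_lt, lt_max_iff, lt_min_iff]
        constructor
        · rintro (h | h)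
          · linarith
          · exact h.1
        · exact fun h => Or.inr ⟨h, htN⟩
      rw [this]
      exact H _ (by linarith)
    · have : {x | t < h x} = ∅ := by
        ext x
        simp only [hh, mem_ofPred_eq, lt_sub_iff_add_lt, lt_max_iff, lt_min_iff, mem_empty_iff_false,
          iff_false]
        rintro (h | h)
        · linarith
        · exact htN h.2
      simp [this]
  have l1 := lintegral_comp_eq_lintegral_meas_lt_mul
    (μ.withDensity fun x => ENNReal.ofReal (f x)) (f := h)
    (g := fun u => (r - 1) * (u + L) ^ (r - 1 - 1))
    (Filter.Eventually.of_forall hh0) hhm.aemeasurable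
    (fun t ht => ((cont _ t ht).const_smul (r - 1)).intervalIntegrable)
    (by
      filter_upwards [ae_restrict_mem measurableSet_Ioi] with t ht
      have : (0:ℝ) < t := ht
      have : 0 ≤ r - 1 := by linarith
      positivity)
  have l2 := lintegral_comp_eq_lintegral_meas_lt_mul μ (f := h)
    (g := fun u => (δ * (r - 1) / r) * (r * (u + L) ^ (r - 1)))
    (Filter.Eventually.of_forall hh0) hhm.aemeasurable
    (fun t ht => (((cont _ t ht).const_smul r).const_smul (δ * (r - 1) / r)).intervalIntegrable)
    (by
      filter_upwards [ae_restrict_mem measurableSet_Ioi] with t ht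
      have : (0:ℝ) < t := ht
      have : 0 ≤ r - 1 := by linarith
      positivity)
  have e1 : ∀ x, ∫ u in (0:ℝ)..h x, (r - 1) * (u + L) ^ (r - 1 - 1) =
      (max L (min (f x) N)) ^ (r - 1) - L ^ (r - 1) := by
    intro x
    rw [prim _ (by linarith) _ (hh0 x)]
    simp [hh]
  have e2 : ∀ x, ∫ u in (0:ℝ)..h x, (δ * (r - 1) / r) * (r * (u + L) ^ (r - 1)) =
      (δ * (r - 1) / r) * ((max L (min (f x) N)) ^ r - L ^ r) := by
    intro x
    rw [intervalIntegral.integral_const_mul, prim _ (by linarith) _ (hh0 x)]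
    simp [hh]
  simp only [e1] at l1
  simp only [e2] at l2
  rw [lintegral_withDensity_eq_lintegral_mul _ (by fun_prop) (by fun_prop)] at l1
  refine (le_of_eq (by simpa using l1)).trans ?_
  rw [l2]
  refine setLIntegral_mono_ae' measurableSet_Ioi (Filter.Eventually.of_forall fun t ht => ?_)
  have ht : (0:ℝ) < t := ht
  refine (mul_le_mul_left (hsets t ht) _).trans (le_of_eq ?_)
  have ht' : 0 < t + L := by linarith
  rw [mul_comm (ENNReal.ofReal _), mul_assoc, ← ENNReal.ofReal_mul (by positivity)]
  congr 2
  rw [Real.rpow_sub_one ht'.ne' (r - 1)]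
  field_simp

theorem integral_mul_min_rpow_le {α : Type*} [MeasurableSpace α] (μ : Measure α)
    [IsFiniteMeasure μ] {f : α → ℝ} (hf : Measurable f) (hf0 : ∀ x, 0 ≤ f x)
    (hfi : Integrable f μ) {δ r L N : ℝ} (hδ : 1 < δ)
    (hr : 1 < r) (hD : 0 < r - (r - 1) * δ) (hL : 0 < L) (hN : L < N)
    (H : ∀ t, L ≤ t → ∫⁻ x in {x | t < f x}, ENNReal.ofReal (f x) ∂μ ≤
      ENNReal.ofReal (δ * t) * μ {x | t < f x}) :
    ∫ x, f x * (min (f x) N) ^ (r - 1) ∂μ ≤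
      L ^ (r - 1) / (r - (r - 1) * δ) * ∫ x, f x ∂μ := by
  have hr0 : 0 < r - 1 := by linarith
  set k : α → ℝ := fun x => max L (min (f x) N) with hk
  have hkm : Measurable k := by fun_prop
  have hkL : ∀ x, L ≤ k x := fun x => le_max_left _ _
  have hkN : ∀ x, k x ≤ N := fun x => max_le hN.le (min_le_right _ _)
  have hk0 : ∀ x, 0 < k x := fun x => hL.trans_le (hkL x)
  have bdd : ∀ s : ℝ, 0 < s → ∀ x, ‖k x ^ s‖ ≤ N ^ s := fun s hs x => by
    rw [Real.norm_of_nonneg (Real.rpow_nonneg (hk0 x).le _)]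
    exact Real.rpow_le_rpow (hk0 x).le (hkN x) hs.le
  have ik : ∀ s : ℝ, 0 < s → Integrable (fun x => k x ^ s) μ := fun s hs =>
    (integrable_const (N ^ s)).mono' (hkm.pow_const s).aestronglyMeasurable
      (Filter.Eventually.of_forall (bdd s hs))
  have ifk : Integrable (fun x => f x * k x ^ (r - 1)) μ :=
    hfi.mul_bdd (hkm.pow_const _).aestronglyMeasurable (Filter.Eventually.of_forall (bdd _ hr0))
  have c1 : ∫ x, f x * (k x ^ (r - 1) - L ^ (r - 1)) ∂μ ≤
      ∫ x, δ * (r - 1) / r * (k x ^ r - L ^ r) ∂μ := by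
    have n1 : ∀ x, 0 ≤ k x ^ (r - 1) - L ^ (r - 1) := fun x =>
      sub_nonneg.2 (Real.rpow_le_rpow hL.le (hkL x) hr0.le)
    have n2 : ∀ x, 0 ≤ δ * (r - 1) / r * (k x ^ r - L ^ r) := fun x =>
      mul_nonneg (by positivity) (sub_nonneg.2 (Real.rpow_le_rpow hL.le (hkL x) (by linarith)))
    have i1 : Integrable (fun x => f x * (k x ^ (r - 1) - L ^ (r - 1))) μ := by
      simp only [mul_sub]
      exact ifk.sub (hfi.mul_const _)
    have i2 : Integrable (fun x => δ * (r - 1) / r * (k x ^ r - L ^ r)) μ :=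
      ((ik r (by linarith)).sub (integrable_const _)).const_mul _
    rw [← ENNReal.ofReal_le_ofReal_iff (integral_nonneg n2),
      ofReal_integral_eq_lintegral_ofReal i1
        (Filter.Eventually.of_forall fun x => mul_nonneg (hf0 x) (n1 x)),
      ofReal_integral_eq_lintegral_ofReal i2 (Filter.Eventually.of_forall n2)]
    simp only [ENNReal.ofReal_mul (hf0 _)]
    exact layer_cake_truncated μ hf (by linarith) hr hL H
  set A : Set α := {x | L < f x} with hA
  have hAm : MeasurableSet A := measurableSet_lt measurable_const hf
  have c2 : ∫ x in A, f x ∂μ ≤ δ * L * μ.real A := by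
    have := H L le_rfl
    rw [← ofReal_integral_eq_lintegral_ofReal hfi.integrableOn
      (Filter.Eventually.of_forall hf0), ← hA, ← ofReal_measureReal,
      ← ENNReal.ofReal_mul (by positivity)] at this
    exact (ENNReal.ofReal_le_ofReal_iff (by positivity)).1 this
  have hoff : ∀ x, x ∉ A → k x = L := fun x hx => by
    have : f x ≤ L := not_lt.1 hx
    exact max_eq_left ((min_le_left _ _).trans this)
  have c1' : ∫ x in A, f x * k x ^ (r - 1) ∂μ - L ^ (r - 1) * ∫ x in A, f x ∂μ ≤
      δ * (r - 1) / r * (∫ x in A, k x ^ r ∂μ - L ^ r * μ.real A) := by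
    have e1 : ∫ x, f x * (k x ^ (r - 1) - L ^ (r - 1)) ∂μ =
        ∫ x in A, f x * k x ^ (r - 1) ∂μ - L ^ (r - 1) * ∫ x in A, f x ∂μ := by
      rw [← setIntegral_eq_integral_of_forall_compl_eq_zero (s := A)
        (fun x hx => by rw [hoff x hx]; simp)]
      simp only [mul_sub]
      rw [integral_sub ifk.integrableOn (hfi.mul_const _).integrableOn, integral_mul_const, mul_comm]
    have e2 : ∫ x, δ * (r - 1) / r * (k x ^ r - L ^ r) ∂μ =
        δ * (r - 1) / r * (∫ x in A, k x ^ r ∂μ - L ^ r * μ.real A) := by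
      rw [← setIntegral_eq_integral_of_forall_compl_eq_zero (s := A)
        (fun x hx => by rw [hoff x hx]; simp), integral_const_mul,
        integral_sub (ik r (by linarith)).integrableOn (integrable_const _), integral_const]
      simp [mul_comm]
    rwa [e1, e2] at c1
  have c3 : ∫ x in A, k x ^ r ∂μ ≤ ∫ x in A, f x * k x ^ (r - 1) ∂μ := by
    refine setIntegral_mono_on (ik r (by linarith)).integrableOn ifk.integrableOn hAm
      fun x hx => ?_
    have : k x ≤ f x := max_le (le_of_lt hx) (min_le_left _ _)
    calc k x ^ r = k x * k x ^ (r - 1) := by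
          rw [Real.rpow_sub_one (hk0 x).ne']; field_simp [(hk0 x).ne']
      _ ≤ _ := mul_le_mul_of_nonneg_right this (Real.rpow_nonneg (hk0 x).le _)
  have c4 : (r - (r - 1) * δ) * ∫ x in A, f x * k x ^ (r - 1) ∂μ ≤
      L ^ (r - 1) * ∫ x in A, f x ∂μ := by
    have hLr : L ^ r = L ^ (r - 1) * L := by
      rw [Real.rpow_sub_one hL.ne']; field_simp
    have h2 : L ^ (r - 1) * ∫ x in A, f x ∂μ ≤ δ * (L ^ r * μ.real A) := by
      rw [hLr]
      have := mul_le_mul_of_nonneg_left c2 (Real.rpow_nonneg hL.le (r - 1))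
      linarith
    have h3 := mul_le_mul_of_nonneg_left c1' (by linarith : 0 ≤ r)
    have h4 : r * (δ * (r - 1) / r * (∫ x in A, k x ^ r ∂μ - L ^ r * μ.real A)) =
      (r - 1) * (δ * ∫ x in A, k x ^ r ∂μ) - (r - 1) * (δ * (L ^ r * μ.real A)) := by
      field_simp
    rw [h4] at h3
    have h5 := mul_le_mul_of_nonneg_left h2 hr0.le
    have h6 := mul_le_mul_of_nonneg_left (mul_le_mul_of_nonneg_left c3 (by linarith : 0 ≤ δ)) hr0.le
    linarith
  have hpt : ∀ x, (r - (r - 1) * δ) * (f x * (min (f x) N) ^ (r - 1)) ≤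
      A.indicator (fun x => (r - (r - 1) * δ) * (f x * k x ^ (r - 1)) - L ^ (r - 1) * f x) x +
        L ^ (r - 1) * f x := by
    intro x
    have hm0 : 0 ≤ min (f x) N := le_min (hf0 x) (by linarith)
    by_cases hx : x ∈ A
    · rw [indicator_of_mem hx]
      have : (min (f x) N) ^ (r - 1) ≤ k x ^ (r - 1) :=
        Real.rpow_le_rpow hm0 (le_max_right _ _) hr0.le
      have := mul_le_mul_of_nonneg_left (mul_le_mul_of_nonneg_left this (hf0 x)) hD.le
      linarith
    · rw [indicator_of_notMem hx, zero_add]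
      have hfx : min (f x) N ≤ L := (min_le_left _ _).trans (not_lt.1 hx)
      have h1 : (min (f x) N) ^ (r - 1) ≤ L ^ (r - 1) := Real.rpow_le_rpow hm0 hfx hr0.le
      have h2 := mul_le_mul_of_nonneg_left h1 (hf0 x)
      have h3 : 0 ≤ f x * (min (f x) N) ^ (r - 1) :=
        mul_nonneg (hf0 x) (Real.rpow_nonneg hm0 _)
      have : r - (r - 1) * δ ≤ 1 := by nlinarith
      nlinarith
  have iA : Integrable (fun x => (r - (r - 1) * δ) * (f x * k x ^ (r - 1)) - L ^ (r - 1) * f x) μ :=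
    (ifk.const_mul _).sub (hfi.const_mul _)
  have fin := integral_mono_of_nonneg (μ := μ) (Filter.Eventually.of_forall fun x =>
      mul_nonneg hD.le (mul_nonneg (hf0 x)
        (Real.rpow_nonneg (le_min (hf0 x) (by linarith : 0 ≤ N)) _)))
    ((iA.indicator hAm).add (hfi.const_mul _)) (Filter.Eventually.of_forall hpt)
  simp only [Pi.add_apply] at fin
  rw [integral_add (iA.indicator hAm) (hfi.const_mul _), integral_indicator hAm,
    integral_sub (ifk.const_mul _).integrableOn (hfi.const_mul _).integrableOn] at fin
  simp only [integral_const_mul] at fin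
  rw [div_mul_eq_mul_div, le_div_iff₀ hD]
  linarith

theorem lintegral_rpow_le_of_level_sets {α : Type*} [MeasurableSpace α] (μ : Measure α)
    [IsFiniteMeasure μ] {F : α → ℝ≥0∞} (hF : Measurable F)
    (hFi : ∫⁻ x, F x ∂μ ≠ ∞) {δ r L : ℝ} (hδ : 1 < δ)
    (hr : 1 < r) (hD : 0 < r - (r - 1) * δ) (hL : 0 < L)
    (H : ∀ t, L ≤ t → ∫⁻ x in {x | ENNReal.ofReal t < F x}, F x ∂μ ≤
      ENNReal.ofReal (δ * t) * μ {x | ENNReal.ofReal t < F x}) :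
    ∫⁻ x, F x ^ r ∂μ ≤ ENNReal.ofReal (L ^ (r - 1) / (r - (r - 1) * δ)) * ∫⁻ x, F x ∂μ := by
  set f : α → ℝ := fun x => (F x).toReal with hf
  have hfm : Measurable f := hF.ennreal_toReal
  have hf0 : ∀ x, 0 ≤ f x := fun x => ENNReal.toReal_nonneg
  have hfin : ∀ᵐ x ∂μ, F x < ∞ := ae_lt_top hF hFi
  have hfF : ∀ᵐ x ∂μ, ENNReal.ofReal (f x) = F x := by
    filter_upwards [hfin] with x hx using ENNReal.ofReal_toReal hx.ne
  have hfi : Integrable f μ := integrable_toReal_of_lintegral_ne_top hF.aemeasurable hFi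
  have Hf : ∀ t, L ≤ t → ∫⁻ x in {x | t < f x}, ENNReal.ofReal (f x) ∂μ ≤
      ENNReal.ofReal (δ * t) * μ {x | t < f x} := by
    intro t ht
    have hs : {x | t < f x} =ᵐ[μ] {x | ENNReal.ofReal t < F x} := by
      filter_upwards [hfin] with x hx
      refine propext ?_
      exact (ENNReal.ofReal_lt_iff_lt_toReal (hL.le.trans ht) hx.ne).symm
    rw [setLIntegral_congr hs, measure_congr hs,
      lintegral_congr_ae (ae_restrict_of_ae hfF)]
    exact H t ht
  have bound : ∀ n : ℕ, L < n → ∫⁻ x, ENNReal.ofReal (f x * (min (f x) n) ^ (r - 1)) ∂μ ≤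
      ENNReal.ofReal (L ^ (r - 1) / (r - (r - 1) * δ)) * ∫⁻ x, F x ∂μ := by
    intro n hn
    have hn0 : (0:ℝ) ≤ n := by linarith
    have h0 : ∀ x, 0 ≤ (min (f x) n) ^ (r - 1) := fun x =>
      Real.rpow_nonneg (le_min (hf0 x) hn0) _
    have i : Integrable (fun x => f x * (min (f x) n) ^ (r - 1)) μ := by
      refine hfi.mul_bdd (c := (n:ℝ) ^ (r - 1))
        ((hfm.min measurable_const).pow_const _).aestronglyMeasurable
        (Filter.Eventually.of_forall fun x => ?_)
      rw [Real.norm_of_nonneg (h0 x)]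
      exact Real.rpow_le_rpow (le_min (hf0 x) hn0) (min_le_right _ _) (by linarith)
    rw [← lintegral_congr_ae hfF, ← ofReal_integral_eq_lintegral_ofReal i
        (Filter.Eventually.of_forall fun x => mul_nonneg (hf0 x) (h0 x)),
      ← ofReal_integral_eq_lintegral_ofReal hfi (Filter.Eventually.of_forall hf0),
      ← ENNReal.ofReal_mul (by positivity)]
    exact ENNReal.ofReal_le_ofReal (integral_mul_min_rpow_le μ hfm hf0 hfi hδ hr hD hL hn Hf)
  have lim : Filter.Tendsto (fun n : ℕ => ∫⁻ x, ENNReal.ofReal (f x * (min (f x) n) ^ (r - 1)) ∂μ)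
      Filter.atTop (nhds (∫⁻ x, F x ^ r ∂μ)) := by
    refine lintegral_tendsto_of_tendsto_of_monotone (fun n => ?_)
      (Filter.Eventually.of_forall fun x m n hmn => ?_) ?_
    · exact (hfm.mul ((hfm.min measurable_const).pow_const _)).ennreal_ofReal.aemeasurable
    · refine ENNReal.ofReal_le_ofReal (mul_le_mul_of_nonneg_left ?_ (hf0 x))
      exact Real.rpow_le_rpow (le_min (hf0 x) (by positivity))
        (min_le_min_left _ (by exact_mod_cast hmn)) (by linarith)
    · filter_upwards [hfF] with x hx
      obtain ⟨m, hm⟩ := exists_nat_ge (f x)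
      refine tendsto_const_nhds.congr' ?_
      filter_upwards [Filter.eventually_ge_atTop m] with n hn
      have : f x ≤ n := hm.trans (by exact_mod_cast hn)
      rw [min_eq_left this, ← hx, ENNReal.ofReal_rpow_of_nonneg (hf0 x) (by linarith)]
      congr 1
      rcases (hf0 x).eq_or_lt with h | h
      · rw [← h]; simp [Real.zero_rpow (by linarith : r ≠ 0)]
      · rw [Real.rpow_sub_one h.ne']; field_simp
  obtain ⟨m, hm⟩ := exists_nat_gt L
  refine le_of_tendsto lim ?_
  filter_upwards [Filter.eventually_ge_atTop m] with n hn
  exact bound n (hm.trans_le (by exact_mod_cast hn))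

theorem connectedComponentIn_eq_Ioo {U : Set ℝ} (hU : IsOpen U) {a b : ℝ} (hab : U ⊆ Ioo a b)
    {x : ℝ} (hx : x ∈ U) :
    ∃ c d, c < d ∧ a ≤ c ∧ d ≤ b ∧ connectedComponentIn U x = Ioo c d ∧ c ∉ U ∧ d ∉ U := by
  set I := connectedComponentIn U x with hI
  have hxI : x ∈ I := mem_connectedComponentIn hx
  have hIU : I ⊆ U := connectedComponentIn_subset U x
  have hIo : IsOpen I := hU.connectedComponentIn
  have hIp : IsPreconnected I := isPreconnected_connectedComponentIn
  have hbb : BddBelow I := ⟨a, fun y hy => (hab (hIU hy)).1.le⟩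
  have hba : BddAbove I := ⟨b, fun y hy => (hab (hIU hy)).2.le⟩
  have hsub : Ioo (sInf I) (sSup I) ⊆ I := IsConnected.Ioo_csInf_csSup_subset ⟨⟨x, hxI⟩, hIp⟩ hbb hba
  have hc : sInf I ∉ I := fun h => by
    obtain ⟨y, hy, hyI⟩ := (Filter.Eventually.and_frequently (hIo.mem_nhds h)
      (frequently_lt_nhds _)).exists
    exact absurd (csInf_le hbb hy) (not_le.2 hyI)
  have hd : sSup I ∉ I := fun h => by
    obtain ⟨y, hy, hyI⟩ := (Filter.Eventually.and_frequently (hIo.mem_nhds h)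
      (frequently_gt_nhds _)).exists
    exact absurd (le_csSup hba hy) (not_le.2 hyI)
  have hcl : ∀ y ∈ I, sInf I < y := fun y hy =>
    (csInf_le hbb hy).lt_of_ne fun h => hc (h ▸ hy)
  have hdl : ∀ y ∈ I, y < sSup I := fun y hy =>
    (le_csSup hba hy).lt_of_ne fun h => hd (h ▸ hy)
  have hIeq : I = Ioo (sInf I) (sSup I) :=
    Subset.antisymm (fun y hy => ⟨hcl y hy, hdl y hy⟩) hsub
  refine ⟨sInf I, sSup I, (hcl x hxI).trans (hdl x hxI),
    le_csInf ⟨x, hxI⟩ fun y hy => (hab (hIU hy)).1.le,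
    csSup_le ⟨x, hxI⟩ fun y hy => (hab (hIU hy)).2.le, hIeq, fun h => ?_, fun h => ?_⟩
  · have : Icc (sInf I) x ⊆ I := by
      refine isPreconnected_Icc.subset_connectedComponentIn (right_mem_Icc.2 (hcl x hxI).le) ?_
      intro y hy
      rcases hy.1.eq_or_lt with h' | h'
      · rwa [← h']
      · exact hIU (hsub ⟨h', hy.2.trans_lt (hdl x hxI)⟩)
    exact hc (this (left_mem_Icc.2 (hcl x hxI).le))
  · have : Icc x (sSup I) ⊆ I := by
      refine isPreconnected_Icc.subset_connectedComponentIn (left_mem_Icc.2 (hdl x hxI).le) ?_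
      intro y hy
      rcases hy.2.eq_or_lt with h' | h'
      · rwa [h']
      · exact hIU (hsub ⟨(hcl x hxI).trans_le hy.1, h'⟩)
    exact hd (this (right_mem_Icc.2 (hdl x hxI).le))

theorem measure_le_of_forall_component {U : Set ℝ} (hU : IsOpen U) {a b : ℝ}
    (hab : U ⊆ Ioo a b) (μ ν : Measure ℝ)
    (H : ∀ c d, c < d → a ≤ c → d ≤ b → Ioo c d ⊆ U → c ∉ U → d ∉ U → ν (Ioo c d) ≤ μ (Ioo c d)) :
    ν U ≤ μ U := by
  set T : Set (Set ℝ) := (connectedComponentIn U) '' U with hT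
  have hopen : ∀ s ∈ T, IsOpen s := by
    rintro _ ⟨x, -, rfl⟩; exact hU.connectedComponentIn
  have hne : ∀ s ∈ T, s.Nonempty := by
    rintro _ ⟨x, hx, rfl⟩; exact ⟨x, mem_connectedComponentIn hx⟩
  have hdisj : T.PairwiseDisjoint id := by
    rintro _ ⟨x, hx, rfl⟩ _ ⟨y, hy, rfl⟩ hxy
    refine Set.disjoint_left.2 fun z hz hz' => hxy ?_
    exact (connectedComponentIn_eq hz).trans (connectedComponentIn_eq hz').symm
  have hcount : T.Countable := hdisj.countable_of_isOpen hopen hne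
  have hUT : U = ⋃₀ T := by
    refine Subset.antisymm (fun x hx => ⟨_, ⟨x, hx, rfl⟩, mem_connectedComponentIn hx⟩) ?_
    rintro y ⟨_, ⟨x, hx, rfl⟩, hy⟩
    exact connectedComponentIn_subset _ _ hy
  rw [hUT, measure_sUnion hcount hdisj fun s hs => (hopen s hs).measurableSet,
    measure_sUnion hcount hdisj fun s hs => (hopen s hs).measurableSet]
  refine ENNReal.tsum_le_tsum ?_
  rintro ⟨_, x, hx, rfl⟩
  obtain ⟨c, d, hcd, hac, hdb, hI, hc, hd⟩ := connectedComponentIn_eq_Ioo hU hab hx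
  simp only [hI]
  exact H c d hcd hac hdb (hI ▸ connectedComponentIn_subset U x) hc hd

theorem exists_continuous_primitive_abs {f : ℝ → ℝ} (hf : Integrable f) :
    ∃ V : ℝ → ℝ, Continuous V ∧ Monotone V ∧ ∀ x y, x ≤ y →
      ∫⁻ t in Ioo x y, ENNReal.ofReal |f t| = ENNReal.ofReal (V y - V x) := by
  have hi : ∀ x y, IntervalIntegrable (fun t => |f t|) volume x y := fun x y =>
    hf.abs.intervalIntegrable
  have key : ∀ x y, (∫ t in (0:ℝ)..y, |f t|) - ∫ t in (0:ℝ)..x, |f t| = ∫ t in x..y, |f t| :=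
    fun x y => intervalIntegral.integral_interval_sub_left (hi _ _) (hi _ _)
  refine ⟨fun x => ∫ t in (0:ℝ)..x, |f t|, hf.abs.continuous_primitive 0, fun x y hxy => ?_,
    fun x y hxy => ?_⟩
  · rw [← sub_nonneg, key]
    exact intervalIntegral.integral_nonneg hxy fun _ _ => abs_nonneg _
  · rw [key, intervalIntegral.integral_of_le hxy, integral_Ioc_eq_integral_Ioo,
      ofReal_integral_eq_lintegral_ofReal hf.abs.integrableOn
        (Filter.Eventually.of_forall fun _ => abs_nonneg _)]

theorem lowerSemicontinuous_Mminus {f : ℝ → ℝ} (hf : Integrable f) :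
    LowerSemicontinuous (Mminus f) := by
  obtain ⟨V, hV, -, hVf⟩ := exists_continuous_primitive_abs hf
  refine lowerSemicontinuous_biSup fun h hh => Continuous.lowerSemicontinuous ?_
  have : ∀ x, ∫⁻ y in Ioo (x - h) x, ENNReal.ofReal |f y| = ENNReal.ofReal (V x - V (x - h)) :=
    fun x => hVf _ _ (by linarith)
  simp only [this, ← ENNReal.ofReal_div_of_pos hh]
  exact ENNReal.continuous_ofReal.comp (by fun_prop)

theorem Mminus_indicator_le_of_average_le {w : ℝ → ℝ} {a b c d t x : ℝ} {V : ℝ → ℝ}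
    (hVw : ∀ x y, x ≤ y → ∫⁻ s in Ioo x y, ENNReal.ofReal |(Ioo a b).indicator w s| =
      ENNReal.ofReal (V y - V x))
    (hac : a ≤ c) (hdb : d ≤ b) (hx : x ∈ Ioo c d) (hle : ∀ y < c, V c - V y ≤ t * (c - y))
    (hge : t * (x - c) ≤ V x - V c) :
    Mminus ((Ioo a b).indicator w) x ≤ Mminus ((Ioo c d).indicator w) x := by
  have hloc : ∀ y, c ≤ y → ∫⁻ s in Ioo y x, ENNReal.ofReal |(Ioo a b).indicator w s| =
      ∫⁻ s in Ioo y x, ENNReal.ofReal |(Ioo c d).indicator w s| := fun y hy =>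
    setLIntegral_congr_fun measurableSet_Ioo fun s hs => by
      have h1 : s ∈ Ioo c d := ⟨hy.trans_lt hs.1, hs.2.trans hx.2⟩
      have h2 : s ∈ Ioo a b := ⟨hac.trans_lt h1.1, h1.2.trans_le hdb⟩
      simp only [indicator_of_mem h1, indicator_of_mem h2]
  have hxc : 0 < x - c := sub_pos.2 hx.1
  refine iSup₂_le fun h hh => ?_
  by_cases hc : c ≤ x - h
  · rw [hloc _ hc]
    exact le_iSup₂ (f := fun (h : ℝ) (_ : 0 < h) =>
      (∫⁻ y in Ioo (x - h) x, ENNReal.ofReal |(Ioo c d).indicator w y|) / ENNReal.ofReal h) h hh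
  · refine le_trans ?_ (le_iSup₂ (f := fun (h : ℝ) (_ : 0 < h) =>
      (∫⁻ y in Ioo (x - h) x, ENNReal.ofReal |(Ioo c d).indicator w y|) / ENNReal.ofReal h)
      (x - c) hxc)
    rw [_root_.sub_sub_cancel, ← hloc c le_rfl, hVw _ _ (by linarith), hVw _ _ hx.1.le,
      ← ENNReal.ofReal_div_of_pos hh, ← ENNReal.ofReal_div_of_pos hxc]
    refine ENNReal.ofReal_le_ofReal ?_
    have h1 := hle (x - h) (not_le.1 hc)
    have hq : 0 < c - (x - h) := sub_pos.2 (not_le.1 hc)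
    rw [div_le_div_iff₀ hh hxc]
    nlinarith [mul_le_mul_of_nonneg_right h1 hxc.le, mul_le_mul_of_nonneg_left hge hq.le]

theorem ofReal_lt_Mminus_iff {f V : ℝ → ℝ} {t x : ℝ} (ht : 0 ≤ t)
    (hVf : ∀ x y, x ≤ y → ∫⁻ s in Ioo x y, ENNReal.ofReal |f s| = ENNReal.ofReal (V y - V x)) :
    ENNReal.ofReal t < Mminus f x ↔ ∃ y < x, t * (x - y) < V x - V y := by
  simp only [Mminus, lt_iSup_iff]
  constructor
  · rintro ⟨h, hh, hlt⟩
    refine ⟨x - h, by linarith, ?_⟩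
    rw [hVf _ _ (by linarith), ← ENNReal.ofReal_div_of_pos hh,
      ENNReal.ofReal_lt_ofReal_iff_of_nonneg ht, lt_div_iff₀ hh] at hlt
    linarith
  · rintro ⟨y, hy, hlt⟩
    have hh : 0 < x - y := sub_pos.2 hy
    refine ⟨x - y, hh, ?_⟩
    rw [hVf _ _ (by linarith), ← ENNReal.ofReal_div_of_pos hh,
      ENNReal.ofReal_lt_ofReal_iff_of_nonneg ht, lt_div_iff₀ hh]
    simpa using hlt

theorem le_of_forall_exists_lt {G : ℝ → ℝ} (hG : Continuous G) {c x : ℝ} (hcx : c ≤ x)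
    (hc : ∀ y < c, G c ≤ G y) (H : ∀ z ∈ Ioc c x, ∃ y < z, G y < G z) : G c ≤ G x := by
  obtain ⟨z, hz, hmin⟩ := isCompact_Icc.exists_isMinOn (nonempty_Icc.2 hcx) hG.continuousOn
  rcases hz.1.eq_or_lt with h | h
  · rw [h]
    exact hmin (right_mem_Icc.2 hcx)
  · obtain ⟨y, hyz, hy⟩ := H z ⟨h, hz.2⟩
    rcases lt_or_ge y c with h' | h'
    · exact absurd ((hmin (left_mem_Icc.2 hcx)).trans (hc y h')) (not_le.2 hy)
    · exact absurd (hmin ⟨h', hyz.le.trans hz.2⟩) (not_le.2 hy)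

theorem lintegral_Mminus_le_Mminus2 (w : ℝ → ℝ) {a b c : ℝ} (hac : a ≤ c) (hcb : c < b) :
    ∫⁻ x in Ioo c b, Mminus ((Ioo c b).indicator w) x ≤
      Mminus2 ((Ioo a b).indicator w) b * volume (Ioo c b) := by
  have hh : 0 < b - c := sub_pos.2 hcb
  have h := le_iSup₂ (f := fun (h : ℝ) (_ : 0 < h) =>
    (∫⁻ y in Ioo (b - h) b, Mminus ((Ioo (b - h) b).indicator ((Ioo a b).indicator w)) y) /
      ENNReal.ofReal h) (b - c) hh
  rw [_root_.sub_sub_cancel, indicator_indicator,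
    inter_eq_left.2 (Ioo_subset_Ioo_left hac), ENNReal.div_le_iff_le_mul
      (Or.inl (ENNReal.ofReal_pos.2 hh).ne') (Or.inl ENNReal.ofReal_ne_top)] at h
  rwa [Real.volume_Ioo]

theorem lintegral_level_set_Mminus_le {w : ℝ → ℝ} (hw : ∀ x, 0 ≤ w x) {δ a b t : ℝ}
    (hδ : 1 < δ) (hFW : ∀ a b : ℝ, a < b →
      (∫⁻ x in Ioo a b, Mminus ((Ioo a b).indicator w) x) ≤
        ENNReal.ofReal δ * ∫⁻ x in Ioo a b, ENNReal.ofReal (w x))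
    (hint : Integrable ((Ioo a b).indicator w)) (ht : 0 < t)
    (hM : Mminus2 ((Ioo a b).indicator w) b ≤ ENNReal.ofReal (δ * t)) :
    ∫⁻ x in {x | ENNReal.ofReal t < Mminus ((Ioo a b).indicator w) x} ∩ Ioo a b,
        Mminus ((Ioo a b).indicator w) x ≤
      ENNReal.ofReal (δ * t) *
        volume ({x | ENNReal.ofReal t < Mminus ((Ioo a b).indicator w) x} ∩ Ioo a b) := by
  set F := Mminus ((Ioo a b).indicator w) with hF
  obtain ⟨V, hVc, hVm, hVw⟩ := exists_continuous_primitive_abs hint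
  have hlsc : LowerSemicontinuous F := lowerSemicontinuous_Mminus hint
  have hU : IsOpen ({x | ENNReal.ofReal t < F x} ∩ Ioo a b) :=
    (hlsc.isOpen_preimage _).inter isOpen_Ioo
  have hlt : ∀ x, ENNReal.ofReal t < F x ↔ ∃ y < x, t * (x - y) < V x - V y :=
    fun x => ofReal_lt_Mminus_iff ht.le hVw
  have hleft : ∀ y < a, V a - V y ≤ 0 := fun y hy => by
    have h := hVw y a hy.le
    rw [setLIntegral_congr_fun (g := fun _ => 0) measurableSet_Ioo fun s hs => by
      simp [indicator_of_notMem (fun h : s ∈ Ioo a b => lt_asymm h.1 hs.2)], lintegral_zero] at h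
    exact ENNReal.ofReal_eq_zero.1 h.symm
  have key := measure_le_of_forall_component hU inter_subset_right
    (ENNReal.ofReal (δ * t) • volume) (volume.withDensity F) ?_
  · rwa [withDensity_apply _ hU.measurableSet] at key
  intro c d hcd hac hdb hsub hc hd
  rw [withDensity_apply _ measurableSet_Ioo, Measure.smul_apply, smul_eq_mul]
  have hle : ∀ y < c, V c - V y ≤ t * (c - y) := fun y hy => by
    rcases hac.eq_or_lt with rfl | hac
    · exact (hleft y hy).trans (mul_nonneg ht.le (sub_pos.2 hy).le)
    · by_contra! h
      exact hc ⟨(hlt c).2 ⟨y, hy, h⟩, hac, hcd.trans_le hdb⟩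
  have hge : ∀ x ∈ Ioo c d, t * (x - c) ≤ V x - V c := fun x hx => by
    have := le_of_forall_exists_lt (G := fun x => V x - t * x) (by fun_prop) hx.1.le
      (fun y hy => by have := hle y hy; linarith) (fun z hz => by
        obtain ⟨y, hy, h⟩ := (hlt z).1 (hsub ⟨hz.1, hz.2.trans_lt hx.2⟩).1
        exact ⟨y, hy, by linarith⟩)
    linarith
  have hmono : ∫⁻ x in Ioo c d, F x ≤ ∫⁻ x in Ioo c d, Mminus ((Ioo c d).indicator w) x :=
    setLIntegral_mono' measurableSet_Ioo fun x hx =>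
      Mminus_indicator_le_of_average_le hVw hac hdb hx hle (hge x hx)
  refine hmono.trans ?_
  rcases hdb.eq_or_lt with rfl | hdb
  · exact (lintegral_Mminus_le_Mminus2 w hac hcd).trans (mul_le_mul_left hM _)
  · refine (hFW c d hcd).trans ?_
    have hVd : V d - V c ≤ t * (d - c) := by
      by_contra! h
      exact hd ⟨(hlt d).2 ⟨c, hcd, h⟩, hac.trans_lt hcd, hdb⟩
    have hwV : ∫⁻ x in Ioo c d, ENNReal.ofReal (w x) = ENNReal.ofReal (V d - V c) := by
      rw [← hVw c d hcd.le]
      refine setLIntegral_congr_fun measurableSet_Ioo fun s hs => ?_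
      have : s ∈ Ioo a b := ⟨hac.trans_lt hs.1, hs.2.trans hdb⟩
      simp only [indicator_of_mem this, abs_of_nonneg (hw s)]
    rw [hwV, Real.volume_Ioo, ENNReal.ofReal_mul (by linarith), mul_assoc,
      ← ENNReal.ofReal_mul ht.le]
    gcongr

/-- Sharp reverse Hölder inequality for `M⁻(w·1_{(a,b)})` for a one-sided `A∞⁺`
weight with Fujii–Wilson constant at most `δ`.  The constant
`δ^{1-r}(r'-1)/(r'-δ)` is written in the equivalent form `δ^{1-r}/(δ-(δ-1)r)`,
valid also at `r = 1`. -/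
theorem stmt10 (w : ℝ → ℝ) (hw : ∀ x, 0 ≤ w x) (hloc : LocallyIntegrable w volume)
    (δ : ℝ) (hδ : 1 < δ)
    (hFW : ∀ a b : ℝ, a < b →
      (∫⁻ x in Set.Ioo a b, Mminus ((Set.Ioo a b).indicator w) x) ≤
        ENNReal.ofReal δ * ∫⁻ x in Set.Ioo a b, ENNReal.ofReal (w x))
    (r : ℝ) (hr1 : 1 ≤ r) (hr2 : r < δ / (δ - 1)) (a b : ℝ) (hab : a < b) :
    (∫⁻ x in Set.Ioo a b, (Mminus ((Set.Ioo a b).indicator w) x) ^ r) ≤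
      ENNReal.ofReal (δ ^ (1 - r) * (1 / (δ - (δ - 1) * r))) *
        (Mminus2 ((Set.Ioo a b).indicator w) b) ^ (r - 1) *
        ∫⁻ x in Set.Ioo a b, Mminus ((Set.Ioo a b).indicator w) x := by
  rcases hr1.eq_or_lt with rfl | hr1
  · simp
  have hD : 0 < δ - (δ - 1) * r := by
    rw [lt_div_iff₀ (by linarith)] at hr2
    linarith
  have hδ0 : 0 < δ := by linarith
  have hr0 : 0 < r - 1 := by linarith
  have hwi : IntegrableOn w (Ioo a b) :=
    (hloc.integrableOn_isCompact isCompact_Icc).mono_set Ioo_subset_Icc_self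
  have hint : Integrable ((Ioo a b).indicator w) := hwi.integrable_indicator measurableSet_Ioo
  have hFm : Measurable (Mminus ((Ioo a b).indicator w)) :=
    (lowerSemicontinuous_Mminus hint).measurable
  have hM2 := lintegral_Mminus_le_Mminus2 w (le_refl a) hab
  have hfin : ∫⁻ x in Ioo a b, Mminus ((Ioo a b).indicator w) x ≠ ∞ := by
    refine ((hFW a b hab).trans_lt (ENNReal.mul_lt_top ENNReal.ofReal_lt_top ?_)).ne
    exact hwi.lintegral_lt_top
  have hS : ∀ t, MeasurableSet {x | ENNReal.ofReal t < Mminus ((Ioo a b).indicator w) x} :=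
    fun t => measurableSet_lt measurable_const hFm
  rcases eq_or_ne (∫⁻ x in Ioo a b, Mminus ((Ioo a b).indicator w) x) 0 with h0 | h0
  · have h : ∫⁻ x in Ioo a b, (Mminus ((Ioo a b).indicator w) x) ^ r = 0 := by
      rw [lintegral_eq_zero_iff hFm] at h0
      rw [lintegral_eq_zero_iff (hFm.pow_const _)]
      filter_upwards [h0] with x hx
      rw [hx]
      exact ENNReal.zero_rpow_of_pos (by linarith)
    rw [h]
    exact zero_le
  rcases eq_or_ne (Mminus2 ((Ioo a b).indicator w) b) ∞ with htop | htop
  · rw [htop, ENNReal.top_rpow_of_pos hr0, ENNReal.mul_top, ENNReal.top_mul h0]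
    · exact le_top
    · exact (ENNReal.ofReal_pos.2 (by positivity)).ne'
  have hpos : Mminus2 ((Ioo a b).indicator w) b ≠ 0 := fun h => by
    rw [h, zero_mul] at hM2
    exact h0 (le_antisymm hM2 zero_le)
  set m := (Mminus2 ((Ioo a b).indicator w) b).toReal with hm
  have hm0 : 0 < m := ENNReal.toReal_pos hpos htop
  have hmM : Mminus2 ((Ioo a b).indicator w) b = ENNReal.ofReal m :=
    (ENNReal.ofReal_toReal htop).symm
  have h := lintegral_rpow_le_of_level_sets (volume.restrict (Ioo a b)) hFm hfin hδ hr1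
    (L := m / δ) (by linarith) (by positivity) fun t ht => ?_
  · refine h.trans (le_of_eq ?_)
    rw [hmM, ENNReal.ofReal_rpow_of_pos hm0, ← ENNReal.ofReal_mul (by positivity)]
    congr 2
    rw [Real.div_rpow hm0.le hδ0.le, show 1 - r = -(r - 1) by ring, Real.rpow_neg hδ0.le,
      show r - (r - 1) * δ = δ - (δ - 1) * r by ring]
    field_simp
  · have ht' : m ≤ δ * t := by rwa [div_le_iff₀' hδ0] at ht
    rw [Measure.restrict_restrict (hS t), Measure.restrict_apply (hS t)]
    refine lintegral_level_set_Mminus_le hw hδ hFW hint (by nlinarith [div_pos hm0 hδ0]) ?_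
    rw [hmM]
    exact ENNReal.ofReal_le_ofReal ht'
end
end

section
/- Let w be a weight on ℝ and let δ ≥ 1. Assume the Fujii–Wilson condition with constant δ: for every bounded interval J, ∫_J M(w·1_J) dx ≤ δ·w(J). Let I be a bounded interval of positive length and let (M(w·1_I))* denote the left-continuous non-increasing rearrangement of the restriction of M(w·1_I) to I, defined on (0,|I|]. Then for every t ∈ (0,|I|], (1/t)∫_0^t (M(w·1_I))*(s) ds ≤ δ · (M(w·1_I))*(t). -/
open MeasureTheory Set ENNReal

noncomputable section

/-- The non-centered Hardy–Littlewood maximal operator on `ℝ`, as a supremum of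
averages over bounded open intervals containing the point. -/
def M1 (f : ℝ → ℝ) (x : ℝ) : ℝ≥0∞ :=
  ⨆ (a : ℝ) (b : ℝ) (_ : a < b) (_ : x ∈ Set.Ioo a b),
    (∫⁻ y in Set.Ioo a b, ENNReal.ofReal |f y|) / volume (Set.Ioo a b)

/-- The left-continuous non-increasing rearrangement on `(0, |I|]` of the
restriction to `I` of a function `g`:
`g*(t) = inf {λ : |{x ∈ I : g(x) > λ}| < t}`. -/
def rearr (g : ℝ → ℝ≥0∞) (I : Set ℝ) (t : ℝ) : ℝ≥0∞ :=
  sInf {lam : ℝ≥0∞ | volume {x ∈ I | lam < g x} < ENNReal.ofReal t}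

/-- The average of `|f|` over `(p, q)` is a lower bound for `M1 f` on `(p, q)`. -/
lemma average_le_M1 (f : ℝ → ℝ) {p q x : ℝ} (hx : x ∈ Ioo p q) :
    (∫⁻ y in Ioo p q, ENNReal.ofReal |f y|) / volume (Ioo p q) ≤ M1 f x :=
  le_iSup_of_le p <| le_iSup_of_le q <| le_iSup_of_le (hx.1.trans hx.2) <|
    le_iSup_of_le hx le_rfl

lemma lt_M1_iff (f : ℝ → ℝ) (c : ℝ≥0∞) (x : ℝ) :
    c < M1 f x ↔ ∃ p q, x ∈ Ioo p q ∧
      c < (∫⁻ y in Ioo p q, ENNReal.ofReal |f y|) / volume (Ioo p q) := by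
  simp only [M1, lt_iSup_iff]
  constructor
  · rintro ⟨p, q, -, hx, h⟩
    exact ⟨p, q, hx, h⟩
  · rintro ⟨p, q, hx, h⟩
    exact ⟨p, q, hx.1.trans hx.2, hx, h⟩

lemma isOpen_setOf_lt_M1 (f : ℝ → ℝ) (c : ℝ≥0∞) : IsOpen {x | c < M1 f x} := by
  rw [isOpen_iff_mem_nhds]
  intro x hx
  obtain ⟨p, q, hxpq, h⟩ := (lt_M1_iff f c x).1 hx
  filter_upwards [Ioo_mem_nhds hxpq.1 hxpq.2] with y hy
  exact (lt_M1_iff f c y).2 ⟨p, q, hy, h⟩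

lemma measurable_M1 (f : ℝ → ℝ) : Measurable (M1 f) :=
  measurable_of_Ioi fun c => (isOpen_setOf_lt_M1 f c).measurableSet

lemma setLIntegral_ofReal_abs_indicator (w : ℝ → ℝ) {I J : Set ℝ} (hI : MeasurableSet I) :
    ∫⁻ y in J, ENNReal.ofReal |I.indicator w y| = ∫⁻ y in I ∩ J, ENNReal.ofReal |w y| := by
  rw [← setLIntegral_indicator hI]
  congr 1 with y
  by_cases hy : y ∈ I <;> simp [hy]

lemma rearr_le {g : ℝ → ℝ≥0∞} {I : Set ℝ} {s : ℝ} {c : ℝ≥0∞}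
    (h : volume {x ∈ I | c < g x} < ENNReal.ofReal s) : rearr g I s ≤ c :=
  sInf_le h

lemma rearr_antitone (g : ℝ → ℝ≥0∞) (I : Set ℝ) : Antitone (rearr g I) := fun _ _ hst =>
  sInf_le_sInf fun _ h => lt_of_lt_of_le h (ENNReal.ofReal_le_ofReal hst)

/-- The superlevel set at height `rearr g I t` has measure at most `t`. -/
lemma volume_rearr_lt_le (g : ℝ → ℝ≥0∞) (I : Set ℝ) (t : ℝ) :
    volume {x ∈ I | rearr g I t < g x} ≤ ENNReal.ofReal t := by
  rcases eq_or_ne (rearr g I t) ∞ with htop | htop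
  · simp [htop]
  obtain ⟨u, hu, hlt, hlim⟩ := exists_seq_strictAnti_tendsto' (lt_top_iff_ne_top.2 htop)
  have hset : {x ∈ I | rearr g I t < g x} = ⋃ n, {x ∈ I | u n < g x} := by
    ext x
    simp only [mem_ofPred_eq, mem_iUnion]
    constructor
    · rintro ⟨hxI, hx⟩
      obtain ⟨n, hn⟩ := (hlim.eventually_lt_const hx).exists
      exact ⟨n, hxI, hn⟩
    · rintro ⟨n, hxI, hn⟩
      exact ⟨hxI, (hlt n).1.trans hn⟩
  have hmono : Monotone fun n => {x ∈ I | u n < g x} := fun m n hmn x hx =>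
    ⟨hx.1, (hu.antitone hmn).trans_lt hx.2⟩
  rw [hset, hmono.measure_iUnion]
  refine iSup_le fun n => ?_
  obtain ⟨c, hc, hcu⟩ := sInf_lt_iff.1 (hlt n).1
  exact (measure_mono (t := {x ∈ I | c < g x}) fun x hx => ⟨hx.1, hcu.trans hx.2⟩).trans
    (le_of_lt hc)

lemma volume_Ioi_ofReal_lt (y : ℝ≥0∞) : volume {r ∈ Ioi (0 : ℝ) | ENNReal.ofReal r < y} = y := by
  rcases eq_or_ne y ∞ with rfl | hy
  · have : {r ∈ Ioi (0 : ℝ) | ENNReal.ofReal r < ∞} = Ioi 0 := by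
      ext r
      simp
    rw [this, Real.volume_Ioi]
  · have : {r ∈ Ioi (0 : ℝ) | ENNReal.ofReal r < y} = Ioo 0 y.toReal := by
      ext r
      simp only [mem_ofPred_eq, mem_Ioi, mem_Ioo]
      refine and_congr_right fun hr => ?_
      rw [ENNReal.ofReal_lt_iff_lt_toReal hr.le hy]
    rw [this, Real.volume_Ioo, sub_zero, ENNReal.ofReal_toReal hy]

/-- The layer cake formula for functions with values in `[0, ∞]`. -/
lemma lintegral_eq_lintegral_measure_ofReal_lt {α : Type*} [MeasurableSpace α] (μ : Measure α)
    [SFinite μ] {f : α → ℝ≥0∞} (hf : Measurable f) :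
    ∫⁻ x, f x ∂μ = ∫⁻ r in Ioi (0 : ℝ), μ {x | ENNReal.ofReal r < f x} := by
  have hm : MeasurableSet {z : α × ℝ | ENNReal.ofReal z.2 < f z.1} :=
    measurableSet_lt (ENNReal.measurable_ofReal.comp measurable_snd) (hf.comp measurable_fst)
  have hleft : ∀ x, ∫⁻ r in Ioi (0 : ℝ),
      {z : α × ℝ | ENNReal.ofReal z.2 < f z.1}.indicator 1 (x, r) = f x := by
    intro x
    have hm' : MeasurableSet {r : ℝ | ENNReal.ofReal r < f x} :=
      measurableSet_lt ENNReal.measurable_ofReal measurable_const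
    calc _ = ∫⁻ r in Ioi (0 : ℝ), {r : ℝ | ENNReal.ofReal r < f x}.indicator 1 r := rfl
      _ = volume {r ∈ Ioi (0 : ℝ) | ENNReal.ofReal r < f x} := by
        rw [lintegral_indicator_one hm', Measure.restrict_apply hm', inter_comm]
        rfl
      _ = f x := volume_Ioi_ofReal_lt _
  have hright : ∀ r : ℝ, ∫⁻ x, {z : α × ℝ | ENNReal.ofReal z.2 < f z.1}.indicator 1 (x, r) ∂μ
      = μ {x | ENNReal.ofReal r < f x} := by
    intro r
    have hm' : MeasurableSet {x | ENNReal.ofReal r < f x} := measurableSet_lt measurable_const hf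
    rw [← lintegral_indicator_one hm']
    rfl
  simp_rw [← hright]
  conv_lhs => enter [2, x]; rw [← hleft x]
  refine lintegral_lintegral_swap (f := fun x r =>
    {z : α × ℝ | ENNReal.ofReal z.2 < f z.1}.indicator (1 : α × ℝ → ℝ≥0∞) (x, r)) ?_
  exact (measurable_one.indicator hm).aemeasurable

lemma lintegral_le_lintegral_of_measure_lt_le {α β : Type*} [MeasurableSpace α]
    [MeasurableSpace β] {μ : Measure α} {ν : Measure β} [SFinite μ] [SFinite ν]
    {f : α → ℝ≥0∞} {g : β → ℝ≥0∞} (hf : Measurable f) (hg : Measurable g)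
    (h : ∀ c, μ {x | c < f x} ≤ ν {y | c < g y}) : ∫⁻ x, f x ∂μ ≤ ∫⁻ y, g y ∂ν := by
  rw [lintegral_eq_lintegral_measure_ofReal_lt μ hf, lintegral_eq_lintegral_measure_ofReal_lt ν hg]
  exact lintegral_mono fun r => h _

/-- The integral of the rearrangement over `(0, t)`, compared with the integral of the function
over the superlevel set at height `rearr g I t`. -/
lemma lintegral_rearr_add_le {g : ℝ → ℝ≥0∞} (hg : Measurable g) {I : Set ℝ}
    (hI : MeasurableSet I) (t : ℝ) :
    (∫⁻ s in Ioo (0 : ℝ) t, rearr g I s)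
        + rearr g I t * volume {x ∈ I | rearr g I t < g x} ≤
      rearr g I t * ENNReal.ofReal t + ∫⁻ x in {x ∈ I | rearr g I t < g x}, g x := by
  set c := rearr g I t
  set E := {x ∈ I | c < g x} with hE
  have hEm : MeasurableSet E := hI.inter (measurableSet_lt measurable_const hg)
  have hrm : Measurable (rearr g I) := (rearr_antitone g I).measurable
  have h1 : ∫⁻ s in Ioo (0 : ℝ) t, rearr g I s ≤
      c * ENNReal.ofReal t + ∫⁻ s in Ioo (0 : ℝ) t, (rearr g I s - c) := by
    calc ∫⁻ s in Ioo (0 : ℝ) t, rearr g I s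
        ≤ ∫⁻ s in Ioo (0 : ℝ) t, (c + (rearr g I s - c)) :=
          lintegral_mono fun s => le_add_tsub
      _ = _ := by
          rw [lintegral_add_left measurable_const, setLIntegral_const, Real.volume_Ioo, sub_zero]
  have h2 : ∫⁻ s in Ioo (0 : ℝ) t, (rearr g I s - c) ≤ ∫⁻ x in E, (g x - c) := by
    refine lintegral_le_lintegral_of_measure_lt_le (hrm.sub_const c) (hg.sub_const c) fun r => ?_
    rw [Measure.restrict_apply (measurableSet_lt measurable_const (hrm.sub_const c)),
      Measure.restrict_apply (measurableSet_lt measurable_const (hg.sub_const c))]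
    have hsub : {x ∈ I | r + c < g x} ⊆ {x | r < g x - c} ∩ E := fun x hx =>
      ⟨lt_tsub_iff_right.2 hx.2, hx.1, le_add_self.trans_lt hx.2⟩
    refine le_trans ?_ (measure_mono hsub)
    set m := volume {x ∈ I | r + c < g x}
    rcases eq_or_ne m ∞ with hm | hm
    · rw [hm]; exact le_top
    calc _ ≤ volume (Ioc 0 m.toReal) := by
          refine measure_mono fun s hs => ⟨hs.2.1, ?_⟩
          by_contra! hlt
          refine absurd (lt_tsub_iff_right.1 hs.1) (not_lt.2 (rearr_le ?_))
          exact (ENNReal.lt_ofReal_iff_toReal_lt hm).2 hlt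
      _ = m := by rw [Real.volume_Ioc, sub_zero, ENNReal.ofReal_toReal hm]
  have h3 : (∫⁻ x in E, (g x - c)) + c * volume E = ∫⁻ x in E, g x := by
    rw [← setLIntegral_const, ← lintegral_add_right _ measurable_const]
    exact setLIntegral_congr_fun hEm fun x hx => tsub_add_cancel_of_le hx.2.le
  calc _ ≤ c * ENNReal.ofReal t + (∫⁻ x in E, (g x - c)) + c * volume E := by
        gcongr; exact h1.trans (by gcongr)
    _ = _ := by rw [add_assoc, h3]

/-- A component of a bounded open set of reals is an open interval whose endpoints lie outside
the set. -/
lemma exists_connectedComponentIn_eq_Ioo {E : Set ℝ} (hE : IsOpen E) {a b x : ℝ}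
    (hab : E ⊆ Ioo a b) (hx : x ∈ E) :
    ∃ c d, c < d ∧ connectedComponentIn E x = Ioo c d ∧ c ∉ E ∧ d ∉ E := by
  set S := connectedComponentIn E x with hS
  have hxS : x ∈ S := mem_connectedComponentIn hx
  have hSE : S ⊆ E := connectedComponentIn_subset E x
  have hconn : IsConnected S := ⟨⟨x, hxS⟩, isPreconnected_connectedComponentIn⟩
  have hb : BddBelow S := ⟨a, fun y hy => (hab (hSE hy)).1.le⟩
  have ha : BddAbove S := ⟨b, fun y hy => (hab (hSE hy)).2.le⟩
  have hSeq : S = Ioo (sInf S) (sSup S) := by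
    refine Subset.antisymm ?_ (hconn.Ioo_csInf_csSup_subset hb ha)
    rw [← interior_Icc]
    exact interior_maximal (fun y hy => ⟨csInf_le hb hy, le_csSup ha hy⟩) hE.connectedComponentIn
  generalize sInf S = c at hSeq
  generalize sSup S = d at hSeq
  have hxcd : x ∈ Ioo c d := hSeq ▸ hxS
  refine ⟨c, d, hxcd.1.trans hxcd.2, hSeq, fun hc => ?_, fun hd => ?_⟩
  · have : Ico c d ⊆ S := isPreconnected_Ico.subset_connectedComponentIn ⟨hxcd.1.le, hxcd.2⟩
      fun y hy => by
        rcases hy.1.eq_or_lt with rfl | h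
        · exact hc
        · exact hSE (hSeq ▸ ⟨h, hy.2⟩)
    have hcS := this ⟨le_rfl, hxcd.1.trans hxcd.2⟩
    rw [hSeq] at hcS
    exact lt_irrefl _ hcS.1
  · have : Ioc c d ⊆ S := isPreconnected_Ioc.subset_connectedComponentIn ⟨hxcd.1, hxcd.2.le⟩
      fun y hy => by
        rcases hy.2.eq_or_lt with rfl | h
        · exact hd
        · exact hSE (hSeq ▸ ⟨hy.1, h⟩)
    have hdS := this ⟨hxcd.1.trans hxcd.2, le_rfl⟩
    rw [hSeq] at hdS
    exact lt_irrefl _ hdS.2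

/-- An integral bound on the components of a bounded open set gives one on the whole set. -/
lemma setLIntegral_le_of_components {E : Set ℝ} (hE : IsOpen E) {a b : ℝ} (hab : E ⊆ Ioo a b)
    {f : ℝ → ℝ≥0∞} {K : ℝ≥0∞}
    (h : ∀ c d, c < d → Ioo c d ⊆ E → c ∉ E → d ∉ E →
      ∫⁻ x in Ioo c d, f x ≤ K * volume (Ioo c d)) :
    ∫⁻ x in E, f x ≤ K * volume E := by
  set C : Set (Set ℝ) := connectedComponentIn E '' E
  have hopen : ∀ S ∈ C, IsOpen S := by
    rintro _ ⟨x, -, rfl⟩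
    exact hE.connectedComponentIn
  have hdisj : C.PairwiseDisjoint id := by
    rintro _ ⟨x, -, rfl⟩ _ ⟨y, -, rfl⟩ hne
    refine disjoint_left.2 fun z hzx hzy => hne ?_
    rw [connectedComponentIn_eq hzx, connectedComponentIn_eq hzy]
  have hcount : C.Countable := hdisj.countable_of_isOpen hopen <| by
    rintro _ ⟨x, hx, rfl⟩
    exact ⟨x, mem_connectedComponentIn hx⟩
  have hmeas : ∀ S ∈ C, MeasurableSet (id S) := fun S hS => (hopen S hS).measurableSet
  have hunion : E = ⋃ S ∈ C, id S := by
    refine Subset.antisymm (fun x hx => mem_biUnion (mem_image_of_mem _ hx)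
      (mem_connectedComponentIn hx)) (iUnion₂_subset ?_)
    rintro _ ⟨x, -, rfl⟩
    exact connectedComponentIn_subset E x
  rw [hunion, lintegral_biUnion hcount hmeas hdisj, measure_biUnion hcount hdisj hmeas,
    ← ENNReal.tsum_mul_left]
  refine ENNReal.tsum_le_tsum ?_
  rintro ⟨_, x, hx, rfl⟩
  obtain ⟨c, d, hcd, heq, hc, hd⟩ := exists_connectedComponentIn_eq_Ioo hE hab hx
  simp only [id, heq]
  exact h c d hcd (heq ▸ connectedComponentIn_subset E x) hc hd

/-- On an interval `(c, d)` that contains every subinterval of the superlevel set it meets, the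
maximal function of `w·1_I` is controlled by that of `w·1_(c,d)`. -/
lemma M1_indicator_le_of_component {w : ℝ → ℝ} {a b c d x : ℝ} {lam : ℝ≥0∞}
    (hcE : c ∉ {y ∈ Ioo a b | lam < M1 ((Ioo a b).indicator w) y})
    (hdE : d ∉ {y ∈ Ioo a b | lam < M1 ((Ioo a b).indicator w) y})
    (hE : Ioo c d ⊆ {y ∈ Ioo a b | lam < M1 ((Ioo a b).indicator w) y})
    (hx : x ∈ Ioo c d) :
    M1 ((Ioo a b).indicator w) x ≤ M1 ((Ioo c d).indicator w) x := by
  have hbig : ∀ p q, x ∈ Ioo p q →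
      lam < (∫⁻ y in Ioo p q, ENNReal.ofReal |(Ioo a b).indicator w y|) / volume (Ioo p q) →
      (∫⁻ y in Ioo p q, ENNReal.ofReal |(Ioo a b).indicator w y|) / volume (Ioo p q) ≤
        M1 ((Ioo c d).indicator w) x := by
    intro p q hxpq hlt
    have hxab : x ∈ Ioo a b := (hE hx).1
    set J := Ioo (max a p) (min b q) with hJ
    have hJeq : Ioo a b ∩ Ioo p q = J := Ioo_inter_Ioo
    have hxJ : x ∈ J := hJeq ▸ ⟨hxab, hxpq⟩
    have hle : (∫⁻ y in Ioo p q, ENNReal.ofReal |(Ioo a b).indicator w y|) / volume (Ioo p q) ≤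
        (∫⁻ y in J, ENNReal.ofReal |w y|) / volume J := by
      rw [setLIntegral_ofReal_abs_indicator w measurableSet_Ioo, hJeq]
      gcongr
      rw [← hJeq]
      exact inter_subset_right
    have hJab : J ⊆ Ioo a b := hJeq ▸ inter_subset_left
    have hJE : J ⊆ {y ∈ Ioo a b | lam < M1 ((Ioo a b).indicator w) y} := by
      intro y hy
      refine ⟨hJab hy, (hlt.trans_le hle).trans_le ?_⟩
      refine le_trans (le_of_eq ?_) (average_le_M1 _ hy)
      rw [setLIntegral_ofReal_abs_indicator w measurableSet_Ioo, inter_eq_right.2 hJab]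
    have hJcd : J ⊆ Ioo c d := by
      intro y hy
      constructor
      · by_contra! hyc
        exact hcE (hJE ⟨hy.1.trans_le hyc, hx.1.trans hxJ.2⟩)
      · by_contra! hyd
        exact hdE (hJE ⟨hxJ.1.trans hx.2, hyd.trans_lt hy.2⟩)
    refine hle.trans (le_trans (le_of_eq ?_) (average_le_M1 _ hxJ))
    rw [setLIntegral_ofReal_abs_indicator w measurableSet_Ioo, inter_eq_right.2 hJcd]
  obtain ⟨p₀, q₀, hx₀, hlt₀⟩ := (lt_M1_iff _ _ _).1 (hE hx).2
  refine iSup_le fun p => iSup_le fun q => iSup_le fun _ => iSup_le fun hxpq => ?_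
  rcases lt_or_ge lam
    ((∫⁻ y in Ioo p q, ENNReal.ofReal |(Ioo a b).indicator w y|) / volume (Ioo p q)) with h | h
  · exact hbig p q hxpq h
  · exact h.trans (hlt₀.le.trans (hbig p₀ q₀ hx₀ hlt₀))

/-- If `M(w·1_I) ≤ λ` at a point `x` and `(c, d) ⊆ I ∩ (p, q)` with `x ∈ (p, q)`, then
`w(c, d) ≤ λ (q - p)`. -/
lemma setLIntegral_le_of_M1_le {w : ℝ → ℝ} {I : Set ℝ} (hI : MeasurableSet I)
    {c d p q x : ℝ} {lam : ℝ≥0∞} (hx : x ∈ Ioo p q) (hM : M1 (I.indicator w) x ≤ lam)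
    (hcd : Ioo c d ⊆ I ∩ Ioo p q) :
    ∫⁻ y in Ioo c d, ENNReal.ofReal |w y| ≤ lam * ENNReal.ofReal (q - p) := by
  have h := (average_le_M1 (I.indicator w) hx).trans hM
  have hpq : 0 < q - p := sub_pos.2 (hx.1.trans hx.2)
  rw [setLIntegral_ofReal_abs_indicator w hI, Real.volume_Ioo,
    ENNReal.div_le_iff (ENNReal.ofReal_pos.2 hpq).ne' ENNReal.ofReal_ne_top] at h
  exact (lintegral_mono_set hcd).trans h

lemma le_mul_ofReal_of_forall_pos {y lam : ℝ≥0∞} (hlam : lam ≠ ∞) {r : ℝ}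
    (h : ∀ ε > 0, y ≤ lam * ENNReal.ofReal (r + ε)) : y ≤ lam * ENNReal.ofReal r := by
  have hcont : Continuous fun ε : ℝ => lam * ENNReal.ofReal (r + ε) :=
    (ENNReal.continuous_const_mul hlam).comp
      (ENNReal.continuous_ofReal.comp (continuous_const.add continuous_id))
  have hlim := (hcont.tendsto 0).mono_left (nhdsWithin_le_nhds (s := Ioi 0))
  simp only [add_zero] at hlim
  exact ge_of_tendsto hlim (eventually_mem_nhdsWithin.mono h)

/-- A component `(c, d)` of a superlevel set `{M(w·1_I) > λ} ∩ I`, with `λ` at least the average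
of `w` over `I`, satisfies `w(c, d) ≤ λ (d - c)`. -/
lemma setLIntegral_component_le {w : ℝ → ℝ} {a b c d : ℝ} {lam : ℝ≥0∞} (hlam : lam ≠ ∞)
    (hab : ∫⁻ y in Ioo a b, ENNReal.ofReal |w y| ≤ lam * ENNReal.ofReal (b - a))
    (hlt : c < d) (hcd : Ioo c d ⊆ Ioo a b)
    (hcE : c ∉ {y ∈ Ioo a b | lam < M1 ((Ioo a b).indicator w) y})
    (hdE : d ∉ {y ∈ Ioo a b | lam < M1 ((Ioo a b).indicator w) y}) :
    ∫⁻ y in Ioo c d, ENNReal.ofReal |w y| ≤ lam * ENNReal.ofReal (d - c) := by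
  obtain ⟨hac, hdb⟩ := (Ioo_subset_Ioo_iff hlt).1 hcd
  rcases hac.eq_or_lt with rfl | hac
  · rcases hdb.eq_or_lt with rfl | hdb
    · exact hab
    · have hM : M1 ((Ioo a b).indicator w) d ≤ lam := by
        by_contra! hM
        exact hdE ⟨⟨hlt, hdb⟩, hM⟩
      refine le_mul_ofReal_of_forall_pos hlam fun ε hε => ?_
      have := setLIntegral_le_of_M1_le (c := a) (d := d) (p := a) (q := d + ε) measurableSet_Ioo
        ⟨hlt, by linarith⟩ hM (subset_inter hcd (Ioo_subset_Ioo_right (by linarith)))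
      convert this using 3
      ring
  · have hM : M1 ((Ioo a b).indicator w) c ≤ lam := by
      by_contra! hM
      exact hcE ⟨⟨hac, hlt.trans_le hdb⟩, hM⟩
    refine le_mul_ofReal_of_forall_pos hlam fun ε hε => ?_
    have := setLIntegral_le_of_M1_le (c := c) (d := d) (p := c - ε) (q := d) measurableSet_Ioo
      ⟨by linarith, hlt⟩ hM (subset_inter hcd (Ioo_subset_Ioo_left (by linarith)))
    convert this using 3
    ring

/-- The average of `w` over `I` is a lower bound for the rearrangement of `M(w·1_I)`. -/
lemma average_le_rearr_M1 (w : ℝ → ℝ) {a b t : ℝ} (hab : a < b) (ht : t ≤ b - a) :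
    ∫⁻ y in Ioo a b, ENNReal.ofReal |w y| ≤
      rearr (M1 ((Ioo a b).indicator w)) (Ioo a b) t * ENNReal.ofReal (b - a) := by
  have hpos : ENNReal.ofReal (b - a) ≠ 0 := (ENNReal.ofReal_pos.2 (sub_pos.2 hab)).ne'
  rw [← ENNReal.div_le_iff hpos ENNReal.ofReal_ne_top]
  refine le_sInf fun lam hl => ?_
  by_contra! hlt
  refine not_lt_of_ge ?_ (show volume _ < ENNReal.ofReal t from hl)
  have hall : {x ∈ Ioo a b | lam < M1 ((Ioo a b).indicator w) x} = Ioo a b := by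
    refine Subset.antisymm (fun x hx => hx.1) fun x hx => ⟨hx, hlt.trans_le ?_⟩
    refine le_trans (le_of_eq ?_) (average_le_M1 _ hx)
    rw [setLIntegral_ofReal_abs_indicator w measurableSet_Ioo, inter_self, Real.volume_Ioo]
  rw [hall, Real.volume_Ioo]
  exact ENNReal.ofReal_le_ofReal ht

/-- For an `A∞` weight `w` with Fujii–Wilson constant at most `δ` and a bounded
interval `I = (a,b)`, the rearrangement of `M(w·1_I)` satisfies the `A₁`-type
estimate `(1/t) ∫_0^t (M(w·1_I))*(s) ds ≤ δ (M(w·1_I))*(t)` for `t ∈ (0,|I|]`. -/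
theorem stmt12 (w : ℝ → ℝ) (hw : ∀ x, 0 ≤ w x) (hloc : LocallyIntegrable w volume)
    (δ : ℝ) (hδ : 1 ≤ δ)
    (hFW : ∀ a b : ℝ, a < b →
      (∫⁻ x in Set.Ioo a b, M1 ((Set.Ioo a b).indicator w) x) ≤
        ENNReal.ofReal δ * ∫⁻ x in Set.Ioo a b, ENNReal.ofReal (w x))
    (a b : ℝ) (hab : a < b) (t : ℝ) (ht0 : 0 < t) (ht1 : t ≤ b - a) :
    (∫⁻ s in Set.Ioo (0 : ℝ) t,
        rearr (M1 ((Set.Ioo a b).indicator w)) (Set.Ioo a b) s) / ENNReal.ofReal t ≤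
      ENNReal.ofReal δ * rearr (M1 ((Set.Ioo a b).indicator w)) (Set.Ioo a b) t := by
  set g := M1 ((Set.Ioo a b).indicator w) with hg
  set lam := rearr g (Ioo a b) t with hlam
  have ht : ENNReal.ofReal t ≠ 0 := (ENNReal.ofReal_pos.2 ht0).ne'
  have hδ0 : ENNReal.ofReal δ ≠ 0 := (ENNReal.ofReal_pos.2 (by linarith)).ne'
  rw [ENNReal.div_le_iff ht ENNReal.ofReal_ne_top]
  rcases eq_or_ne lam ∞ with htop | hfin
  · rw [htop, ENNReal.mul_top hδ0, ENNReal.top_mul ht]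
    exact le_top
  set E := {x ∈ Ioo a b | lam < g x} with hE
  have hEt : volume E ≤ ENNReal.ofReal t := volume_rearr_lt_le g (Ioo a b) t
  have hmain : ∫⁻ x in E, g x ≤ ENNReal.ofReal δ * lam * volume E := by
    refine setLIntegral_le_of_components (isOpen_Ioo.inter (isOpen_setOf_lt_M1 _ lam))
      (fun x hx => hx.1) fun c d hcd hsub hc hd => ?_
    calc ∫⁻ x in Ioo c d, g x ≤ ∫⁻ x in Ioo c d, M1 ((Ioo c d).indicator w) x :=
          setLIntegral_mono' measurableSet_Ioo fun x hx =>
            M1_indicator_le_of_component hc hd hsub hx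
      _ ≤ ENNReal.ofReal δ * ∫⁻ x in Ioo c d, ENNReal.ofReal (w x) := hFW c d hcd
      _ = ENNReal.ofReal δ * ∫⁻ x in Ioo c d, ENNReal.ofReal |w x| := by
          simp_rw [abs_of_nonneg (hw _)]
      _ ≤ ENNReal.ofReal δ * (lam * volume (Ioo c d)) := by
          rw [Real.volume_Ioo]
          gcongr
          exact setLIntegral_component_le hfin (average_le_rearr_M1 w hab ht1) hcd
            (fun x hx => (hsub hx).1) hc hd
      _ = _ := by rw [mul_assoc]
  have hsplit : ENNReal.ofReal δ = 1 + ENNReal.ofReal (δ - 1) := by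
    rw [← ENNReal.ofReal_one, ← ENNReal.ofReal_add zero_le_one (by linarith)]
    congr 1
    ring
  have hEfin : lam * volume E ≠ ∞ :=
    ENNReal.mul_ne_top hfin (ne_top_of_le_ne_top ENNReal.ofReal_ne_top hEt)
  refine (ENNReal.add_le_add_iff_right hEfin).1 ?_
  calc _ ≤ lam * ENNReal.ofReal t + ∫⁻ x in E, g x :=
        lintegral_rearr_add_le (measurable_M1 _) measurableSet_Ioo t
    _ ≤ lam * ENNReal.ofReal t + ENNReal.ofReal δ * lam * volume E := by gcongr
    _ = lam * ENNReal.ofReal t + ENNReal.ofReal (δ - 1) * lam * volume E + lam * volume E := by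
        rw [hsplit]; ring
    _ ≤ lam * ENNReal.ofReal t + ENNReal.ofReal (δ - 1) * lam * ENNReal.ofReal t
          + lam * volume E := by gcongr
    _ = ENNReal.ofReal δ * lam * ENNReal.ofReal t + lam * volume E := by rw [hsplit]; ring
end
end
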